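/- arXiv:2401.13994 — 2 statements merged into one kernel-verified Lean document; each statement's English description precedes it below -/
import Mathlib

section
/- Let p be an odd prime and let G be the split metacyclic p-group G = ⟨a, b | a^(p^n) = b^(p^m) = 1, b a b⁻¹ = a^r⟩ with n ≥ 2, m ≥ 1, gcd(r, p^n) = 1 and r of multiplicative order p^s modulo p^n, 1 ≤ s ≤ min{n−1, m}. If n − s ≥ m, then there is an isomorphism of ℚ-algebras ℚG ≅ ℚ ⊕ ⨁_{λ=1}^{m} (p^λ + p^{λ−1}) copies of ℚ(ζ_{p^λ}) ⊕ ⨁_{λ=m+1}^{n−s} p^m copies of ℚ(ζ_{p^λ}) ⊕ ⨁_{t=1}^{s} p^{m−t} copies of M_{p^t}(ℚ(ζ_{p^{n−s}})). -/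
set_option synthInstance.maxHeartbeats 1000000
set_option maxHeartbeats 1000000

/-- A two-sided ideal which behaves like a maximal one. -/
def MaxLike {A : Type*} [Ring A] (I : TwoSidedIdeal A) : Prop :=
  ∀ J : TwoSidedIdeal A, ¬ J ≤ I → ∃ e ∈ J, 1 - e ∈ I

theorem maxLike_ker {A X : Type*} [Ring A] [Ring X] [IsSimpleRing X] (f : A →+* X)
    (hf : Function.Surjective f) : MaxLike (TwoSidedIdeal.ker f) := by
  intro J hJ
  obtain ⟨u, huJ, hu⟩ : ∃ u ∈ J, u ∉ TwoSidedIdeal.ker f := by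
    by_contra h
    push Not at h
    exact hJ fun x hx => h x hx
  rw [TwoSidedIdeal.mem_ker] at hu
  let M : TwoSidedIdeal X := TwoSidedIdeal.mk' {x | ∃ e ∈ J, f e = x}
    ⟨0, J.zero_mem, map_zero f⟩
    (by rintro _ _ ⟨e, he, rfl⟩ ⟨e', he', rfl⟩; exact ⟨e + e', J.add_mem he he', map_add f _ _⟩)
    (by rintro _ ⟨e, he, rfl⟩; exact ⟨-e, J.neg_mem he, map_neg f _⟩)
    (by
      rintro x _ ⟨e, he, rfl⟩
      obtain ⟨y, rfl⟩ := hf x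
      exact ⟨y * e, J.mul_mem_left _ _ he, map_mul f _ _⟩)
    (by
      rintro _ x ⟨e, he, rfl⟩
      obtain ⟨y, rfl⟩ := hf x
      exact ⟨e * y, J.mul_mem_right _ _ he, map_mul f _ _⟩)
  have h1 : (1 : X) ∈ M := by
    apply IsSimpleRing.one_mem_of_ne_zero_mem M hu
    rw [TwoSidedIdeal.mem_mk']
    exact ⟨u, huJ, rfl⟩
  rw [TwoSidedIdeal.mem_mk'] at h1
  obtain ⟨e, he, h⟩ := h1
  exact ⟨e, he, by rw [TwoSidedIdeal.mem_ker, map_sub, map_one, h, sub_self]⟩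

theorem maxLike_ker' {A X : Type*} [Ring A] [Algebra ℚ A] [Ring X] [Algebra ℚ X] [IsSimpleRing X]
    (f : A →ₐ[ℚ] X) (hf : Function.Surjective f) : MaxLike (TwoSidedIdeal.ker f) :=
  maxLike_ker (f : A →+* X) hf

theorem crt_aux {A ι : Type*} [Ring A] [Fintype ι] (I : ι → TwoSidedIdeal A)
    (hI : ∀ i, MaxLike (I i)) (hinj : Function.Injective I) (x : ι → A) :
    ∃ y, ∀ i, y - x i ∈ I i := by
  classical
  have pair : ∀ i j, i ≠ j → ∃ e ∈ I j, 1 - e ∈ I i := by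
    intro i j hij
    by_cases h : I j ≤ I i
    · have h' : ¬ I i ≤ I j := fun h' => hij (hinj (le_antisymm h' h))
      obtain ⟨e, he, he'⟩ := hI j _ h'
      exact ⟨1 - e, he', by simpa using he⟩
    · exact hI i _ h
  have fin : ∀ i, ∀ T : Finset ι, i ∉ T → ∃ e, 1 - e ∈ I i ∧ ∀ j ∈ T, e ∈ I j := by
    intro i T
    induction T using Finset.induction_on with
    | empty => intro _; exact ⟨1, by simp, by simp⟩
    | insert j T hj ih =>
      intro hi
      rw [Finset.mem_insert, not_or] at hi
      obtain ⟨e, he, heT⟩ := ih hi.2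
      obtain ⟨d, hd, hd'⟩ := pair i j hi.1
      refine ⟨e * d, ?_, ?_⟩
      · have : 1 - e * d = (1 - e) + e * (1 - d) := by noncomm_ring
        rw [this]
        exact (I i).add_mem he ((I i).mul_mem_left _ _ hd')
      · intro k hk
        rcases Finset.mem_insert.1 hk with rfl | hk
        · exact (I k).mul_mem_left _ _ hd
        · exact (I k).mul_mem_right _ _ (heT k hk)
  choose e he he' using fun i => fin i (Finset.univ.erase i) (by simp)
  refine ⟨∑ i, x i * e i, fun i => ?_⟩
  rw [← Finset.add_sum_erase _ _ (Finset.mem_univ i)]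
  have : x i * e i + ∑ j ∈ Finset.univ.erase i, x j * e j - x i
      = x i * (-(1 - e i)) + ∑ j ∈ Finset.univ.erase i, x j * e j := by noncomm_ring
  rw [this]
  refine (I i).add_mem ((I i).mul_mem_left _ _ ((I i).neg_mem (he i))) ?_
  apply sum_mem
  intro j hj
  refine (I i).mul_mem_left _ _ (he' j i ?_)
  simpa [eq_comm] using hj

/-- Arithmetic of `r`. -/
theorem r_arith (p n s : ℕ) (r : ℤ) (hp : p.Prime) (hodd : Odd p)
    (hs1 : 1 ≤ s) (hsn : s ≤ n - 1)
    (hord : orderOf ((r : ZMod (p ^ n))) = p ^ s) :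
    ∃ k : ℤ, r = 1 + p ^ (n - s) * k ∧ ¬ (p : ℤ) ∣ k := by
  have := Fact.mk hp
  have key : ∀ e : ℕ, (r : ZMod (p ^ n)) ^ e = 1 ↔ (p : ℤ) ^ n ∣ r ^ e - 1 := by
    intro e
    rw [← sub_eq_zero]
    have := ZMod.intCast_zmod_eq_zero_iff_dvd (r ^ e - 1) (p ^ n)
    push_cast at this
    exact this
  have h1 : (p : ℤ) ^ n ∣ r ^ p ^ s - 1 := by
    rw [← key, ← hord]; exact pow_orderOf_eq_one _
  have h2 : ¬ (p : ℤ) ^ n ∣ r ^ p ^ (s - 1) - 1 := by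
    rw [← key]
    intro h
    have h3 := orderOf_dvd_of_pow_eq_one h
    rw [hord, Nat.pow_dvd_pow_iff_le_right hp.one_lt] at h3
    omega
  have hpr : (p : ℤ) ∣ r - 1 := by
    have h3 : (p : ℤ) ∣ r ^ p ^ s - 1 := dvd_trans (dvd_pow_self _ (by omega)) h1
    rw [← ZMod.intCast_zmod_eq_zero_iff_dvd] at h3 ⊢
    push_cast at h3 ⊢
    rwa [ZMod.pow_card_pow] at h3
  have hnr : ¬ (p : ℤ) ∣ r := by
    intro h
    have h3 : (p : ℤ) ∣ 1 := by simpa using dvd_sub h hpr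
    exact hp.one_lt.ne' (by exact_mod_cast Int.eq_one_of_dvd_one (by positivity) h3)
  have lte : ∀ e : ℕ, emultiplicity (p : ℤ) (r ^ p ^ e - 1) = emultiplicity (p : ℤ) (r - 1) + e := by
    intro e
    have := Int.emultiplicity_pow_sub_pow hp hodd (x := r) (y := 1) hpr hnr (p ^ e)
    rw [one_pow] at this
    rw [this]
    congr 1
    exact_mod_cast emultiplicity_pow_self_of_prime hp.prime e
  have hd : (p : ℤ) ^ (n - s) ∣ r - 1 := by
    rw [pow_dvd_iff_le_emultiplicity] at h1 ⊢
    rw [lte] at h1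
    have : ((n - s : ℕ) : ℕ∞) + s = n := by norm_cast; omega
    rw [← this] at h1
    exact (ENat.add_le_add_iff_right (ENat.natCast_ne_top s)).1 h1
  obtain ⟨k, hk⟩ := hd
  refine ⟨k, by linarith, fun hpk => h2 ?_⟩
  have h4 : (p : ℤ) ^ (n - s + 1) ∣ r - 1 := by
    rw [hk, pow_succ]; exact mul_dvd_mul_left _ hpk
  rw [pow_dvd_iff_le_emultiplicity] at h4 ⊢
  rw [lte]
  have : (n : ℕ∞) = ((n - s + 1 : ℕ) : ℕ∞) + (s - 1 : ℕ) := by norm_cast; omega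
  rw [this]
  gcongr

theorem conj_zpow_aux {G : Type*} [Group G] {a b : G} {r : ℤ} (h : b * a * b⁻¹ = a ^ r)
    (j : ℕ) (k : ℤ) : b ^ j * a ^ k = a ^ (r ^ j * k) * b ^ j := by
  induction j generalizing k with
  | zero => simp
  | succ j ih =>
    have h1 : b * a ^ k = a ^ (r * k) * b := by
      have : b * a ^ k * b⁻¹ = (b * a * b⁻¹) ^ k := (conj_zpow).symm
      rw [h, ← zpow_mul] at this
      rw [← this]; group
    rw [pow_succ, mul_assoc, h1, ← mul_assoc, ih, mul_assoc, pow_succ, ← mul_assoc (r ^ j)]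

theorem normal_form {G : Type*} [Group G] [Finite G] {a b : G} {r : ℤ} (h : b * a * b⁻¹ = a ^ r)
    (hgen : Subgroup.closure {a, b} = ⊤) (g : G) : ∃ (i : ℤ) (j : ℕ), g = a ^ i * b ^ j := by
  have hg : g ∈ Subgroup.closure {a, b} := by rw [hgen]; trivial
  have key : ∀ g ∈ Submonoid.closure ({a, b} : Set G), ∃ (i : ℤ) (j : ℕ), g = a ^ i * b ^ j := by
    intro g hg
    induction hg using Submonoid.closure_induction with
    | mem x hx =>
      rcases hx with rfl | rfl
      · exact ⟨1, 0, by simp⟩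
      · exact ⟨0, 1, by simp⟩
    | one => exact ⟨0, 0, by simp⟩
    | mul x y _ _ hx hy =>
      obtain ⟨i, j, rfl⟩ := hx
      obtain ⟨k, l, rfl⟩ := hy
      refine ⟨i + r ^ j * k, j + l, ?_⟩
      rw [mul_assoc, ← mul_assoc (b ^ j), conj_zpow_aux h, zpow_add, pow_add]
      group
  apply key
  rw [← Subgroup.mem_toSubmonoid, Subgroup.closure_toSubmonoid_of_finite] at hg
  exact hg

theorem lift_exists {G H : Type*} [Group G] [Group H] {a b : G} {r : ℤ} (N M : ℕ)
    (hN : 0 < N) (hM : 0 < M)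
    (hcard : Nat.card G = N * M) (ha : orderOf a = N) (hb : orderOf b = M)
    (h : b * a * b⁻¹ = a ^ r)
    (hgen : Subgroup.closure {a, b} = ⊤) (x y : H) (hx : x ^ N = 1) (hy : y ^ M = 1)
    (hxy : y * x * y⁻¹ = x ^ r) : ∃ f : G →* H, f a = x ∧ f b = y := by
  classical
  have : Finite G := Nat.finite_of_card_ne_zero (by rw [hcard]; positivity)
  have hsurj : Function.Surjective
      (fun q : Subgroup.zpowers a × Subgroup.zpowers b => (q.1 : G) * q.2) := by
    intro g
    obtain ⟨i, j, rfl⟩ := normal_form h hgen g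
    exact ⟨(⟨a ^ i, i, rfl⟩, ⟨b ^ j, j, by simp⟩), rfl⟩
  have hinj : Function.Injective
      (fun q : Subgroup.zpowers a × Subgroup.zpowers b => (q.1 : G) * q.2) := by
    have := Fintype.ofFinite G
    refine ((Nat.bijective_iff_surjective_and_card _).2 ⟨hsurj, ?_⟩).1
    rw [Nat.card_prod, Nat.card_zpowers, Nat.card_zpowers, ha, hb, hcard]
  have wd : ∀ (i k : ℤ) (j l : ℕ), a ^ i * b ^ j = a ^ k * b ^ l → x ^ i * y ^ j = x ^ k * y ^ l := by
    intro i k j l e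
    have := @hinj (⟨a ^ i, i, rfl⟩, ⟨b ^ j, j, by simp⟩) (⟨a ^ k, k, rfl⟩, ⟨b ^ l, l, by simp⟩) e
    have this : a ^ i = a ^ k ∧ b ^ j = b ^ l :=
      ⟨congrArg (fun q => (q.1 : G)) this, congrArg (fun q => (q.2 : G)) this⟩
    have hxo : orderOf x ∣ orderOf a := by rw [ha]; exact orderOf_dvd_of_pow_eq_one hx
    have hyo : orderOf y ∣ orderOf b := by rw [hb]; exact orderOf_dvd_of_pow_eq_one hy
    have e1 := zpow_eq_zpow_iff_modEq.1 this.1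
    have e2 := pow_eq_pow_iff_modEq.1 this.2
    rw [zpow_eq_zpow_iff_modEq.2 (e1.of_dvd (by exact_mod_cast hxo)),
      pow_eq_pow_iff_modEq.2 (e2.of_dvd hyo)]
  choose i j hij using normal_form h hgen
  have val : ∀ (k : ℤ) (l : ℕ) g, g = a ^ k * b ^ l → x ^ i g * y ^ j g = x ^ k * y ^ l := by
    intro k l g hg
    apply wd
    rw [← hij, hg]
  refine ⟨MonoidHom.mk' (fun g => x ^ i g * y ^ j g) ?_, ?_, ?_⟩
  · intro g g'
    have : g * g' = a ^ (i g + r ^ j g * i g') * b ^ (j g + j g') := by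
      conv_lhs => rw [hij g, hij g']
      rw [mul_assoc, ← mul_assoc (b ^ j g), conj_zpow_aux h, zpow_add, pow_add]
      group
    rw [val _ _ _ this]
    rw [mul_assoc, ← mul_assoc (y ^ j g), conj_zpow_aux hxy, zpow_add, pow_add]
    group
  · simpa using val 1 0 a (by simp)
  · simpa using val 0 1 b (by simp)

theorem r_arith' (p n s : ℕ) (r : ℤ) (hp : p.Prime) (hodd : Odd p)
    (hs1 : 1 ≤ s) (hsn : s ≤ n - 1)
    (hord : orderOf ((r : ZMod (p ^ n))) = p ^ s) :
    ∃ k : ℕ, r ≡ ((1 + p ^ (n - s) * k : ℕ) : ℤ) [ZMOD ((p ^ n : ℕ) : ℤ)] ∧ ¬ p ∣ k := by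
  obtain ⟨k, hk, hpk⟩ := r_arith p n s r hp hodd hs1 hsn hord
  have hpos : (0 : ℤ) < (p : ℤ) ^ s := by have := hp.pos; positivity
  obtain ⟨k', hk'⟩ := Int.eq_ofNat_of_zero_le (Int.emod_nonneg k hpos.ne')
  have hdiv : (p : ℤ) ^ s ∣ k - k' := by
    rw [← hk']; exact Int.dvd_self_sub_emod
  refine ⟨k', ?_, fun h => hpk ?_⟩
  · apply Int.ModEq.symm
    rw [Int.modEq_iff_dvd, hk]
    push_cast
    have : (1 + (p : ℤ) ^ (n - s) * k - (1 + (p : ℤ) ^ (n - s) * k')) = (p : ℤ) ^ (n - s) * (k - k') := by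
      ring
    rw [this]
    have e : n = (n - s) + s := by omega
    conv_lhs => rw [e, pow_add]
    exact mul_dvd_mul_left _ hdiv
  · have h1 : (p : ℤ) ∣ k' := by exact_mod_cast h
    have h2 : (p : ℤ) ∣ k - k' := dvd_trans (dvd_pow_self _ (by omega)) hdiv
    simpa using dvd_add h2 h1

section mat
variable {K : Type*} [Field K]

/-- The `k`-th power of the generalized shift matrix. -/
def shiftP (N : ℕ) (w : K) (k : ℕ) : Matrix (Fin N) (Fin N) K :=
  Matrix.of fun i j => if (j.1 + k) % N = i.1 then w ^ ((j.1 + k) / N) else 0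

/-- The generalized clock matrix. -/
def clockD (N : ℕ) (x : K) : Matrix (Fin N) (Fin N) K := Matrix.diagonal fun j => x ^ j.1

theorem shiftP_mul_apply (N : ℕ) (w : K) (k : ℕ) (M : Matrix (Fin N) (Fin N) K) (i j : Fin N) :
    (M * shiftP N w k) i j
      = M i ⟨(j.1 + k) % N, Nat.mod_lt _ j.pos⟩ * w ^ ((j.1 + k) / N) := by
  rw [Matrix.mul_apply, Finset.sum_eq_single ⟨(j.1 + k) % N, Nat.mod_lt _ j.pos⟩]
  · simp [shiftP]
  · intro b _ hb
    have : ¬ (j.1 + k) % N = b.1 := fun h => hb (Fin.ext h.symm)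
    simp [shiftP, this]
  · simp

theorem shiftP_zero (N : ℕ) (w : K) : shiftP N w 0 = 1 := by
  ext i j
  have h1 := Nat.mod_eq_of_lt j.2
  have h2 := Nat.div_eq_of_lt j.2
  simp [shiftP, Matrix.one_apply, h1, h2, Fin.ext_iff, eq_comm]

theorem shiftP_mul (N : ℕ) (w : K) (k l : ℕ) :
    shiftP N w k * shiftP N w l = shiftP N w (k + l) := by
  ext i j
  have hN : 0 < N := j.pos
  rw [shiftP_mul_apply]
  have h1 : ((j.1 + l) % N + k) % N = (j.1 + (k + l)) % N := by
    rw [Nat.mod_add_mod]; congr 1; ring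
  have h2 : (j.1 + (k + l)) / N = (j.1 + l) / N + ((j.1 + l) % N + k) / N := by
    have : j.1 + (k + l) = ((j.1 + l) % N + k) + N * ((j.1 + l) / N) := by
      have := Nat.mod_add_div (j.1 + l) N
      omega
    rw [this, Nat.add_mul_div_left _ _ hN]; omega
  simp only [shiftP, Matrix.of_apply, h1, h2]
  split_ifs
  · rw [← pow_add, add_comm]
  · simp

theorem shiftP_pow (N : ℕ) (w : K) (k : ℕ) : shiftP N w 1 ^ k = shiftP N w k := by
  induction k with
  | zero => rw [pow_zero, shiftP_zero]
  | succ k ih => rw [pow_succ, ih, shiftP_mul]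

theorem shiftP_scalar (N : ℕ) (w : K) (q : ℕ) :
    shiftP N w (N * q) = w ^ q • (1 : Matrix (Fin N) (Fin N) K) := by
  ext i j
  have h1 := Nat.mod_eq_of_lt j.2
  have h2 := Nat.div_eq_of_lt j.2
  have h3 : (j.1 + N * q) / N = q := by
    rw [Nat.add_mul_div_left _ _ j.pos, h2, zero_add]
  simp [shiftP, Matrix.one_apply, h1, h3, Fin.ext_iff, eq_comm]

theorem clockD_shiftP (N : ℕ) (w x : K) (hx : x ^ N = 1) (k : ℕ) :
    clockD N x * shiftP N w k = x ^ k • (shiftP N w k * clockD N x) := by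
  ext i j
  have : x ^ ((j.1 + k) % N) = x ^ (j.1 + k) := (pow_eq_pow_mod _ hx).symm
  simp only [clockD, Matrix.diagonal_mul, Matrix.smul_apply, Matrix.mul_diagonal, shiftP,
    Matrix.of_apply, smul_eq_mul]
  split_ifs with h
  · rw [← h, this]; ring
  · simp

theorem clockD_pow (N : ℕ) (x : K) (k : ℕ) : clockD N x ^ k = clockD N (x ^ k) := by
  simp only [clockD, Matrix.diagonal_pow]
  congr 1
  ext j
  simp [← pow_mul, mul_comm]

theorem clockD_one (N : ℕ) : clockD N (1 : K) = 1 := by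
  simp [clockD]

theorem sum_clockD (N : ℕ) (x : K) (hN : 0 < N) (hx : IsPrimitiveRoot x N) :
    ∑ k ∈ Finset.range N, clockD N x ^ k
      = (N : K) • Matrix.single ⟨0, hN⟩ ⟨0, hN⟩ (1 : K) := by
  ext i j
  rw [Matrix.sum_apply]
  simp only [clockD_pow]
  simp only [clockD, Matrix.diagonal_apply, Matrix.smul_apply, Matrix.single_apply, smul_eq_mul]
  by_cases hij : i = j
  · subst hij
    by_cases h0 : i = ⟨0, hN⟩
    · subst h0; simp
    · have h0' : ¬ (⟨0, hN⟩ : Fin N) = i := fun h => h0 h.symm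
      simp only [if_true, h0', false_and, if_false, mul_zero]
      have hne : x ^ i.1 ≠ 1 := by
        apply hx.pow_ne_one_of_pos_of_lt _ i.2
        intro h; exact h0 (Fin.ext h)
      have := geom_sum_eq hne N
      rw [← pow_mul, mul_comm, pow_mul, hx.pow_eq_one, one_pow, sub_self, zero_div] at this
      simpa [← pow_mul, mul_comm] using this
  · have : ¬ (⟨0, hN⟩ = i ∧ ⟨0, hN⟩ = j) := fun h => hij (h.1.symm.trans h.2)
    simp [hij, this]

theorem single_eq_shift (N : ℕ) (w : K) (hw : w ≠ 0) (hN : 0 < N) (i j : Fin N) :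
    Matrix.single i j (1 : K) = w⁻¹ • (shiftP N w i.1 *
      (Matrix.single ⟨0, hN⟩ ⟨0, hN⟩ (1 : K) * shiftP N w (N - j.1))) := by
  ext i' j'
  rw [Matrix.smul_apply, ← mul_assoc, shiftP_mul_apply]
  have hj := j.2
  have hj' := j'.2
  by_cases h : (j'.1 + (N - j.1)) % N = 0
  · have hjj : j = j' := by
      have hd := Nat.dvd_of_mod_eq_zero h
      obtain ⟨c, hc⟩ := hd
      have hc1 : c = 1 := by
        have : c < 2 := by
          by_contra hcc
          have : N * 2 ≤ N * c := Nat.mul_le_mul_left _ (by omega)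
          omega
        have : c ≠ 0 := by rintro rfl; omega
        omega
      subst hc1
      apply Fin.ext; omega
    subst hjj
    have h1 : j.1 + (N - j.1) = N := by omega
    simp only [h1, Nat.mod_self, Nat.div_self hN, pow_one, smul_eq_mul]
    by_cases hi : i = i'
    · subst hi
      simp [shiftP, hw, Nat.mod_eq_of_lt i.2, Nat.div_eq_of_lt i.2]
    · have : ¬ i.1 = i'.1 := fun h => hi (Fin.ext h)
      simp [shiftP, hi, Nat.mod_eq_of_lt i.2, this]
  · have hjj : j ≠ j' := by
      rintro rfl
      apply h
      rw [show j.1 + (N - j.1) = N by omega, Nat.mod_self]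
    have h2 : (⟨0, hN⟩ : Fin N) ≠ ⟨(j'.1 + (N - j.1)) % N, Nat.mod_lt _ hN⟩ := by
      intro hh; exact h (Fin.mk.inj hh).symm
    rw [Matrix.single_apply, if_neg (fun hh => hjj hh.2), Matrix.mul_single_apply_of_ne]
    · simp
    · exact h2.symm

theorem surj_aux [Algebra ℚ K] (N : ℕ) (hN : 0 < N) (w x : K) (hw : w ≠ 0)
    (hx : IsPrimitiveRoot x N) [CharZero K] (hK : Algebra.adjoin ℚ {w} = ⊤)
    (S : Subalgebra ℚ (Matrix (Fin N) (Fin N) K)) (hS : shiftP N w 1 ∈ S)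
    (e : ℕ) (hD : w ^ e • clockD N x ∈ S) : S = ⊤ := by
  have hP : ∀ k, shiftP N w k ∈ S := fun k => by
    rw [← shiftP_pow]; exact S.pow_mem hS k
  have hsc : ∀ c : K, algebraMap K (Matrix (Fin N) (Fin N) K) c ∈ S := by
    let f : K →ₐ[ℚ] Matrix (Fin N) (Fin N) K := IsScalarTower.toAlgHom ℚ K _
    have : Algebra.adjoin ℚ {w} ≤ S.comap f := by
      rw [Algebra.adjoin_le_iff]
      intro z hz
      rw [Set.mem_singleton_iff] at hz
      rw [hz]
      change f w ∈ S
      have := hP (N * 1)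
      rw [shiftP_scalar, pow_one] at this
      rwa [IsScalarTower.toAlgHom_apply, Algebra.algebraMap_eq_smul_one]
    intro c
    rw [hK] at this
    exact this (Algebra.mem_top (x := c))
  have hsm : ∀ (c : K) (M : Matrix (Fin N) (Fin N) K), M ∈ S → c • M ∈ S := by
    intro c M hM
    rw [Algebra.smul_def]
    exact S.mul_mem (hsc c) hM
  have hD' : clockD N x ∈ S := by
    have := hsm (w ^ e)⁻¹ _ hD
    rwa [smul_smul, inv_mul_cancel₀ (pow_ne_zero _ hw), one_smul] at this
  have hE : Matrix.single ⟨0, hN⟩ ⟨0, hN⟩ (1 : K) ∈ S := by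
    have h1 : ∑ k ∈ Finset.range N, clockD N x ^ k ∈ S := sum_mem fun k _ => S.pow_mem hD' k
    rw [sum_clockD N x hN hx] at h1
    have h2 := hsm (N : K)⁻¹ _ h1
    have hNK : (N : K) ≠ 0 := by exact_mod_cast hN.ne'
    rwa [smul_smul, inv_mul_cancel₀ hNK, one_smul] at h2
  rw [eq_top_iff]
  intro M _
  rw [Matrix.matrix_eq_sum_single M]
  refine sum_mem fun i _ => sum_mem fun j _ => ?_
  have : Matrix.single i j (M i j) = M i j • Matrix.single i j (1 : K) := by
    rw [Matrix.smul_single, smul_eq_mul, mul_one]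
  rw [this, single_eq_shift N w hw hN]
  exact hsm _ _ (hsm _ _ (S.mul_mem (hP _) (S.mul_mem hE (hP _))))

end mat

/-- Value of an algebra map at a group element. -/
noncomputable def ev {G X : Type*} [Group G] [Ring X] [Algebra ℚ X] (F : MonoidAlgebra ℚ G →ₐ[ℚ] X) :
    G →* X := (F : MonoidAlgebra ℚ G →* X).comp (MonoidAlgebra.of ℚ G)

theorem ev_apply {G X : Type*} [Group G] [Ring X] [Algebra ℚ X] (F : MonoidAlgebra ℚ G →ₐ[ℚ] X)
    (g : G) : ev F g = F (MonoidAlgebra.of ℚ G g) := rfl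

theorem ev_eq_iff {G X : Type*} [Group G] [Ring X] [Algebra ℚ X] (F : MonoidAlgebra ℚ G →ₐ[ℚ] X)
    (g h : G) : ev F g = ev F h ↔
      MonoidAlgebra.of ℚ G g - MonoidAlgebra.of ℚ G h ∈ TwoSidedIdeal.ker F := by
  rw [TwoSidedIdeal.mem_ker, map_sub, sub_eq_zero]; rfl

theorem ev_congr {G X Y : Type*} [Group G] [Ring X] [Algebra ℚ X] [Ring Y] [Algebra ℚ Y]
    {F : MonoidAlgebra ℚ G →ₐ[ℚ] X} {F' : MonoidAlgebra ℚ G →ₐ[ℚ] Y}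
    (h : TwoSidedIdeal.ker F = TwoSidedIdeal.ker F') (g g' : G) :
    ev F g = ev F g' ↔ ev F' g = ev F' g' := by
  rw [ev_eq_iff, ev_eq_iff, h]

/-- The universal property of the metacyclic group, for algebra maps. -/
def LiftProp {G : Type} [Group G] (a b : G) (N M R : ℕ) : Prop :=
  ∀ (X : Type) [Ring X] [Algebra ℚ X] (x y : X), x ^ N = 1 → y ^ M = 1 → y * x = x ^ R * y →
    ∃ F : MonoidAlgebra ℚ G →ₐ[ℚ] X, ev F a = x ∧ ev F b = y

theorem liftProp_of {G : Type} [Group G] {a b : G} {r : ℤ} (N M R : ℕ)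
    (hN : 0 < N) (hM : 0 < M)
    (hcard : Nat.card G = N * M) (ha : orderOf a = N) (hb : orderOf b = M)
    (h : b * a * b⁻¹ = a ^ r) (hR : r ≡ (R : ℤ) [ZMOD (N : ℤ)])
    (hgen : Subgroup.closure {a, b} = ⊤) : LiftProp a b N M R := by
  intro X _ _ x y hx hy hxy
  have h' : b * a * b⁻¹ = a ^ (R : ℤ) := by
    rw [h, zpow_eq_zpow_iff_modEq, ha]; exact hR
  let x' : Xˣ := Units.ofPowEqOne x N hx hN.ne'
  let y' : Xˣ := Units.ofPowEqOne y M hy hM.ne'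
  obtain ⟨f, hfa, hfb⟩ := lift_exists N M hN hM hcard ha hb h' hgen x' y'
    (Units.pow_ofPowEqOne _ _) (Units.pow_ofPowEqOne _ _) (by
      rw [mul_inv_eq_iff_eq_mul, zpow_natCast]
      ext
      simpa [x', y'] using hxy)
  refine ⟨MonoidAlgebra.lift ℚ X G ((Units.coeHom X).comp f), ?_, ?_⟩
  · simp [ev_apply, hfa, x']
  · simp [ev_apply, hfb, y']

instance cycInst (Q : ℕ) [NeZero Q] : IsCyclotomicExtension {Q} ℚ (CyclotomicField Q ℚ) :=
  CyclotomicField.isCyclotomicExtension Q ℚ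

theorem cyc_adjoin (Q : ℕ) [NeZero Q] (w : CyclotomicField Q ℚ) (hw : IsPrimitiveRoot w Q) :
    Algebra.adjoin ℚ {w} = ⊤ :=
  IsCyclotomicExtension.adjoin_primitive_root_eq_top hw

theorem rep3 {G : Type} [Group G] {a b : G} (p n m s u k : ℕ) (hp : p.Prime)
    (hu : n = u + s) (hmu : m ≤ u) (hsm : s ≤ m) (hk : ¬ p ∣ k)
    (hl : LiftProp a b (p ^ n) (p ^ m) (1 + p ^ u * k))
    (t : ℕ) (ht1 : 1 ≤ t) (hts : t ≤ s) (i : ℕ) (hi : i < p ^ (m - t)) :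
    ∃ F : MonoidAlgebra ℚ G →ₐ[ℚ] Matrix (Fin (p ^ t)) (Fin (p ^ t)) (CyclotomicField (p ^ u) ℚ),
      Function.Surjective F ∧ ev F (a * b) ≠ ev F (b * a) ∧
      ev F (a ^ p ^ (u + t)) = ev F 1 ∧ ev F (a ^ p ^ (u + t - 1)) ≠ ev F 1 ∧
      ev F (b ^ p ^ t) = ev F (a ^ (p ^ t * (p ^ (u - m + t) * i))) ∧
      ∀ i' < p ^ (m - t), ev F (b ^ p ^ t) = ev F (a ^ (p ^ t * (p ^ (u - m + t) * i'))) → i' = i := by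
  have hpp := hp.pos
  have : NeZero (p ^ u) := ⟨(pow_pos hpp _).ne'⟩
  have hN : 0 < p ^ t := pow_pos hpp _
  obtain ⟨w, hw⟩ : ∃ w : CyclotomicField (p ^ u) ℚ, IsPrimitiveRoot w (p ^ u) :=
    ⟨_, IsCyclotomicExtension.zeta_spec (p ^ u) ℚ _⟩
  have hw0 : w ≠ 0 := hw.ne_zero (pow_pos hpp _).ne'
  have hxk : IsPrimitiveRoot (w ^ (p ^ (u - t))) (p ^ t) :=
    hw.pow (pow_pos hpp _) (by rw [← pow_add]; congr 1; omega)
  have hx : IsPrimitiveRoot (w ^ (p ^ (u - t) * k)) (p ^ t) := by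
    rw [pow_mul]
    exact hxk.pow_of_coprime k (Nat.Coprime.pow_right _ ((Nat.Prime.coprime_iff_not_dvd hp).2 hk).symm)
  set x := w ^ (p ^ (u - t) * k) with hxdef
  set P := shiftP (p ^ t) w with hPdef
  set c := w ^ (p ^ (u - m) * i) with hc
  have hsplit : ∀ e, t ≤ e → p ^ e = p ^ t * p ^ (e - t) := by
    intro e he; rw [← pow_add]; congr 1; omega
  have hw1 : ∀ e, u ≤ e → w ^ p ^ e = 1 := fun e he =>
    (hw.pow_eq_one_iff_dvd _).2 (pow_dvd_pow _ he)
  have hsu : p ^ u * k = p ^ t * (p ^ (u - t) * k) := by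
    rw [← mul_assoc, ← hsplit u (by omega)]
  have hR : P 1 ^ (1 + p ^ u * k) = x • P 1 := by
    rw [hPdef, shiftP_pow, ← shiftP_mul, hsu, shiftP_scalar, ← hxdef,
      mul_smul_comm, mul_one]
  have hcpow : ∀ e, (c • clockD (p ^ t) x) ^ e = c ^ e • clockD (p ^ t) (x ^ e) := by
    intro e; rw [smul_pow, clockD_pow]
  have hcm : c ^ p ^ m = 1 := by
    rw [hc, ← pow_mul, mul_right_comm, ← pow_add, pow_mul, hw1 _ (by omega), one_pow]
  have hxm : x ^ p ^ m = 1 := (hx.pow_eq_one_iff_dvd _).2 (pow_dvd_pow _ (by omega))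
  obtain ⟨F, hFa, hFb⟩ := hl _ (P 1) (c • clockD (p ^ t) x)
    (by rw [hPdef, shiftP_pow, hsplit n (by omega), shiftP_scalar, hw1 _ (by omega), one_smul])
    (by rw [hcpow, hcm, hxm, clockD_one, one_smul])
    (by rw [hR, smul_mul_assoc, clockD_shiftP _ _ _ hx.pow_eq_one, pow_one, mul_smul_comm,
          smul_mul_assoc, smul_comm])
  have hFak : ∀ e, ev F (a ^ e) = P e := by
    intro e; rw [map_pow, hFa, hPdef, shiftP_pow]
  have hsc : ∀ z z' : CyclotomicField (p ^ u) ℚ,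
      z • (1 : Matrix (Fin (p ^ t)) (Fin (p ^ t)) (CyclotomicField (p ^ u) ℚ)) = z' • 1 → z = z' := by
    intro z z' h
    have := congrFun (congrFun h ⟨0, hN⟩) ⟨0, hN⟩
    simpa using this
  have hFbt : ev F (b ^ p ^ t) = c ^ p ^ t • 1 := by
    rw [map_pow, hFb, hcpow, hx.pow_eq_one, clockD_one]
  refine ⟨F, ?_, ?_, ?_, ?_, ?_, ?_⟩
  · rw [← AlgHom.range_eq_top]
    exact surj_aux (p ^ t) hN w x hw0 hx (cyc_adjoin _ w hw) _
      ⟨_, hFa⟩ _ ⟨_, hFb⟩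
  · rw [map_mul, map_mul, hFa, hFb, smul_mul_assoc, clockD_shiftP _ _ _ hx.pow_eq_one, pow_one,
      mul_smul_comm]
    intro h
    have hc0 : c ≠ 0 := pow_ne_zero _ hw0
    have h2 := smul_right_injective _ hc0 h
    have h3 := congrFun (congrFun h2 ⟨1 % p ^ t, Nat.mod_lt _ hN⟩) ⟨0, hN⟩
    have h4 : P 1 ⟨1 % p ^ t, Nat.mod_lt _ hN⟩ ⟨0, hN⟩ ≠ 0 := by
      simp [hPdef, shiftP, hw0]
    simp only [clockD, Matrix.mul_diagonal, Matrix.smul_apply, pow_zero, mul_one,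
      smul_eq_mul] at h3
    have h5 : x = 1 := mul_right_cancel₀ h4 (by rw [← h3, one_mul])
    have h6 : p ^ t = 1 := hx.unique (by rw [h5]; exact IsPrimitiveRoot.one)
    have h7 : 1 < p ^ t := Nat.one_lt_pow (by omega) hp.one_lt
    omega
  · rw [hFak, map_one, hsplit (u + t) (by omega), hPdef, shiftP_scalar, hw1 _ (by omega), one_smul]
  · rw [hFak, map_one, hsplit (u + t - 1) (by omega), hPdef, shiftP_scalar]
    intro h
    have h1 := hsc _ 1 (by rw [h, one_smul])
    rw [hw.pow_eq_one_iff_dvd, Nat.pow_dvd_pow_iff_le_right hp.one_lt] at h1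
    omega
  · rw [hFbt, hFak, hPdef, shiftP_scalar, hc, ← pow_mul, pow_add, mul_right_comm]
  · intro i' hi' h
    rw [hFbt, hFak, hPdef, shiftP_scalar, hc, ← pow_mul, mul_right_comm, ← pow_add] at h
    have h1 := hsc _ _ h
    have hprim : IsPrimitiveRoot (w ^ p ^ (u - m + t)) (p ^ (m - t)) :=
      hw.pow (pow_pos hpp _) (by rw [← pow_add]; congr 1; omega)
    rw [pow_mul, pow_mul] at h1
    exact (hprim.pow_inj hi hi' h1).symm

/-- Common properties of the one-dimensional components. -/
def AbProp {G X : Type} [Group G] [Ring X] [Algebra ℚ X] (a b : G) (p L : ℕ)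
    (F : MonoidAlgebra ℚ G →ₐ[ℚ] X) : Prop :=
  Function.Surjective F ∧ ev F (a * b) = ev F (b * a) ∧
    ev F (a ^ p ^ L) = ev F 1 ∧ ev F (b ^ p ^ L) = ev F 1 ∧
    ¬ (ev F (a ^ p ^ (L - 1)) = ev F 1 ∧ ev F (b ^ p ^ (L - 1)) = ev F 1)

theorem repAb {G : Type} [Group G] {a b : G} (p n m u k : ℕ) (hp : p.Prime)
    (hu : u ≤ n) (hl : LiftProp a b (p ^ n) (p ^ m) (1 + p ^ u * k))
    (L : ℕ) (hL : 1 ≤ L) (e f : ℕ) (he : p ^ L ∣ e * p ^ u) (hf : p ^ L ∣ f * p ^ m)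
    (hef : ¬ p ∣ e ∨ ¬ p ∣ f) :
    ∃ (F : MonoidAlgebra ℚ G →ₐ[ℚ] CyclotomicField (p ^ L) ℚ) (w : CyclotomicField (p ^ L) ℚ),
      AbProp a b p L F ∧ IsPrimitiveRoot w (p ^ L) ∧ ev F a = w ^ e ∧ ev F b = w ^ f := by
  have hpp := hp.pos
  have : NeZero (p ^ L) := ⟨(pow_pos hpp _).ne'⟩
  obtain ⟨w, hw⟩ : ∃ w : CyclotomicField (p ^ L) ℚ, IsPrimitiveRoot w (p ^ L) :=
    ⟨_, IsCyclotomicExtension.zeta_spec (p ^ L) ℚ _⟩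
  have he1 : (w ^ e) ^ p ^ u = 1 := by
    rw [← pow_mul]; exact (hw.pow_eq_one_iff_dvd _).2 he
  obtain ⟨F, hFa, hFb⟩ := hl _ (w ^ e) (w ^ f)
    (by
      have : p ^ n = p ^ u * p ^ (n - u) := by rw [← pow_add]; congr 1; omega
      rw [this, pow_mul, he1, one_pow])
    (by rw [← pow_mul]; exact (hw.pow_eq_one_iff_dvd _).2 hf)
    (by rw [pow_add, pow_one, pow_mul (w ^ e), he1, one_pow, mul_one, mul_comm])
  have gen : ∀ c, ¬ p ∣ c → IsPrimitiveRoot (w ^ c) (p ^ L) := fun c hc =>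
    hw.pow_of_coprime c (Nat.Coprime.pow_right _ ((Nat.Prime.coprime_iff_not_dvd hp).2 hc).symm)
  have h1L : ∀ c, (w ^ c) ^ p ^ L = 1 := fun c => by
    rw [← pow_mul, mul_comm, pow_mul, hw.pow_eq_one, one_pow]
  refine ⟨F, w, ⟨?_, ?_, ?_, ?_, ?_⟩, hw, hFa, hFb⟩
  · rw [← AlgHom.range_eq_top, eq_top_iff]
    rcases hef with h | h
    · rw [← cyc_adjoin _ _ (gen e h), Algebra.adjoin_le_iff, Set.singleton_subset_iff]
      exact ⟨_, hFa⟩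
    · rw [← cyc_adjoin _ _ (gen f h), Algebra.adjoin_le_iff, Set.singleton_subset_iff]
      exact ⟨_, hFb⟩
  · rw [map_mul, map_mul, mul_comm]
  · rw [map_pow, hFa, h1L, map_one]
  · rw [map_pow, hFb, h1L, map_one]
  · rw [map_pow, map_pow, hFa, hFb, map_one]
    rintro ⟨h1, h2⟩
    have key : ∀ c, ¬ p ∣ c → (w ^ c) ^ p ^ (L - 1) ≠ 1 := by
      intro c hc hh
      rw [(gen c hc).pow_eq_one_iff_dvd, Nat.pow_dvd_pow_iff_le_right hp.one_lt] at hh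
      omega
    rcases hef with h | h
    · exact key e h h1
    · exact key f h h2

/-- Components of level `l + 1 ≤ m`. -/
def Prop1 {G X : Type} [Group G] [Ring X] [Algebra ℚ X] (a b : G) (p l i : ℕ)
    (F : MonoidAlgebra ℚ G →ₐ[ℚ] X) : Prop :=
  AbProp a b p (l + 1) F ∧
    (i < p ^ (l + 1) → ev F b = ev F (a ^ i) ∧
      ∀ i' < p ^ (l + 1), ev F b = ev F (a ^ i') → i' = i) ∧
    (p ^ (l + 1) ≤ i → (∀ i', ev F b ≠ ev F (a ^ i')) ∧
      ev F a = ev F (b ^ (p * (i - p ^ (l + 1)))) ∧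
      ∀ i' < p ^ l, ev F a = ev F (b ^ (p * i')) → i' = i - p ^ (l + 1))

theorem rep1 {G : Type} [Group G] {a b : G} (p n m u k : ℕ) (hp : p.Prime)
    (hu : u ≤ n) (hmu : m ≤ u) (hl : LiftProp a b (p ^ n) (p ^ m) (1 + p ^ u * k))
    (l : ℕ) (hlm : l < m) (i : ℕ) (hi : i < p ^ (l + 1) + p ^ l) :
    ∃ F : MonoidAlgebra ℚ G →ₐ[ℚ] CyclotomicField (p ^ (l + 1)) ℚ, Prop1 a b p l i F := by
  have hpp := hp.pos
  have hp1 : ¬ p ∣ 1 := fun h => hp.one_lt.ne' (Nat.dvd_one.1 h)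
  by_cases h : i < p ^ (l + 1)
  · obtain ⟨F, w, hF, hw, ha, hb⟩ := repAb p n m u k hp hu hl (l + 1) (by omega) 1 i
      (Dvd.dvd.mul_left (pow_dvd_pow _ (by omega)) _)
      (Dvd.dvd.mul_left (pow_dvd_pow _ (by omega)) _) (Or.inl hp1)
    rw [pow_one] at ha
    refine ⟨F, hF, fun _ => ⟨?_, fun i' hi' hh => ?_⟩, fun h' => by omega⟩
    · rw [map_pow, ha, hb]
    · rw [map_pow, ha, hb] at hh
      exact (hw.pow_inj h hi' hh).symm
  · obtain ⟨F, w, hF, hw, ha, hb⟩ := repAb p n m u k hp hu hl (l + 1) (by omega)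
      (p * (i - p ^ (l + 1))) 1
      (Dvd.dvd.mul_left (pow_dvd_pow _ (by omega)) _)
      (Dvd.dvd.mul_left (pow_dvd_pow _ (by omega)) _) (Or.inr hp1)
    rw [pow_one] at hb
    refine ⟨F, hF, fun h' => absurd h' h, fun _ => ⟨fun i' hh => ?_, ?_, fun i' hi' hh => ?_⟩⟩
    · rw [map_pow, ha, hb] at hh
      have h3 : w ^ p ^ l = 1 := by
        rw [hh, ← pow_mul, ← pow_mul, hw.pow_eq_one_iff_dvd]
        exact ⟨(i - p ^ (l + 1)) * i', by ring⟩
      rw [hw.pow_eq_one_iff_dvd, Nat.pow_dvd_pow_iff_le_right hp.one_lt] at h3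
      omega
    · rw [map_pow, ha, hb]
    · rw [map_pow, ha, hb, pow_mul, pow_mul] at hh
      have hprim : IsPrimitiveRoot (w ^ p) (p ^ l) := hw.pow (pow_pos hpp _) (by ring)
      exact (hprim.pow_inj (by omega) hi' hh).symm

theorem rep2 {G : Type} [Group G] {a b : G} (p n m u k : ℕ) (hp : p.Prime)
    (hu : u ≤ n) (hl : LiftProp a b (p ^ n) (p ^ m) (1 + p ^ u * k))
    (l : ℕ) (hlm : m + 1 + l ≤ u) (i : ℕ) (hi : i < p ^ m) :
    ∃ F : MonoidAlgebra ℚ G →ₐ[ℚ] CyclotomicField (p ^ (m + 1 + l)) ℚ, 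
      AbProp a b p (m + 1 + l) F ∧ ev F b = ev F (a ^ (p ^ (l + 1) * i)) ∧
      ∀ i' < p ^ m, ev F b = ev F (a ^ (p ^ (l + 1) * i')) → i' = i := by
  have hpp := hp.pos
  have hp1 : ¬ p ∣ 1 := fun h => hp.one_lt.ne' (Nat.dvd_one.1 h)
  obtain ⟨F, w, hF, hw, ha, hb⟩ := repAb p n m u k hp hu hl (m + 1 + l) (by omega) 1
    (p ^ (l + 1) * i)
    (Dvd.dvd.mul_left (pow_dvd_pow _ (by omega)) _)
    ⟨i, by ring⟩ (Or.inl hp1)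
  rw [pow_one] at ha
  refine ⟨F, hF, ?_, fun i' hi' hh => ?_⟩
  · rw [map_pow, ha, hb]
  · rw [map_pow, ha, hb, pow_mul, pow_mul] at hh
    have hprim : IsPrimitiveRoot (w ^ p ^ (l + 1)) (p ^ m) := hw.pow (pow_pos hpp _) (by ring)
    exact (hprim.pow_inj hi hi' hh).symm

theorem abProp_level {G X Y : Type} [Group G] [Ring X] [Algebra ℚ X] [Ring Y] [Algebra ℚ Y]
    {a b : G} {p L L' : ℕ}
    {F : MonoidAlgebra ℚ G →ₐ[ℚ] X} {F' : MonoidAlgebra ℚ G →ₐ[ℚ] Y}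
    (hF : AbProp a b p L F) (hF' : AbProp a b p L' F')
    (h : TwoSidedIdeal.ker F = TwoSidedIdeal.ker F') : L' ≤ L := by
  by_contra hlt
  push Not at hlt
  obtain ⟨-, -, h1, h2, -⟩ := hF
  obtain ⟨-, -, -, -, h3⟩ := hF'
  apply h3
  rw [ev_congr h] at h1 h2
  have e : p ^ (L' - 1) = p ^ L * p ^ (L' - 1 - L) := by rw [← pow_add]; congr 1; omega
  rw [e, pow_mul, pow_mul, map_pow, map_pow _ (b ^ p ^ L), h1, h2, map_one, one_pow]
  exact ⟨rfl, rfl⟩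

theorem dim_aux (p m v s : ℕ) (hp : p.Prime) (hv : 1 ≤ m + v) (hsm : s ≤ m) :
    1 + ((∑ l : Fin m, (p ^ (l.1 + 1) + p ^ l.1) * (p ^ (l.1 + 1)).totient) +
      ((∑ l : Fin v, p ^ m * (p ^ (m + 1 + l.1)).totient) +
      ∑ j : Fin s, p ^ (m - (j.1 + 1)) *
        (p ^ (j.1 + 1) * p ^ (j.1 + 1) * (p ^ (m + v)).totient))) = p ^ (m + v + s + m) := by
  obtain ⟨q, rfl⟩ : ∃ q, p = q + 1 := ⟨p - 1, by have := hp.pos; omega⟩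
  have tot : ∀ e, ((q + 1) ^ (e + 1)).totient = (q + 1) ^ e * q := fun e => by
    rw [Nat.totient_prime_pow_succ hp]; rfl
  have h1 : ∀ m, 1 + ∑ l : Fin m, ((q + 1) ^ (l.1 + 1) + (q + 1) ^ l.1) *
      ((q + 1) ^ (l.1 + 1)).totient = (q + 1) ^ (m + m) := by
    intro m
    induction m with
    | zero => simp
    | succ m ih =>
      rw [Fin.sum_univ_castSucc, ← add_assoc]
      simp only [Fin.val_castSucc, Fin.val_last]
      rw [ih, tot]; ring
  have h2 : ∀ v, (q + 1) ^ (m + m) + ∑ l : Fin v, (q + 1) ^ m * ((q + 1) ^ (m + 1 + l.1)).totient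
      = (q + 1) ^ (m + v + m) := by
    intro v
    induction v with
    | zero => simp
    | succ v ih =>
      rw [Fin.sum_univ_castSucc, ← add_assoc]
      simp only [Fin.val_castSucc, Fin.val_last]
      rw [ih, show m + 1 + v = (m + v) + 1 by ring, tot]; ring
  have h3 : ∀ s, s ≤ m → (q + 1) ^ (m + v + m) + ∑ j : Fin s, (q + 1) ^ (m - (j.1 + 1)) *
        ((q + 1) ^ (j.1 + 1) * (q + 1) ^ (j.1 + 1) * ((q + 1) ^ (m + v)).totient)
      = (q + 1) ^ (m + v + s + m) := by
    intro s
    induction s with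
    | zero => simp
    | succ s ih =>
      intro hs
      rw [Fin.sum_univ_castSucc, ← add_assoc]
      simp only [Fin.val_castSucc, Fin.val_last]
      rw [ih (by omega)]
      obtain ⟨d, rfl⟩ : ∃ d, m = d + (s + 1) := ⟨m - (s + 1), by omega⟩
      rw [show d + (s + 1) + v = (d + s + v) + 1 by ring, tot,
        show d + (s + 1) - (s + 1) = d by omega]
      ring
  rw [← add_assoc, ← add_assoc, h1, h2, h3 s hsm]

/-- **Theorem (Wedderburn decomposition, case `n - s ≥ m`).**
Let `p` be an odd prime and let
`G = ⟨a, b | a^(p^n) = b^(p^m) = 1, b a b⁻¹ = a^r⟩` be the split metacyclic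
`p`-group, with `n ≥ 2`, `m ≥ 1`, `gcd(r, p^n) = 1`, `r` of multiplicative
order `p^s` modulo `p^n` and `1 ≤ s ≤ min {n-1, m}`.  (Such a group is
characterized up to isomorphism by: `|G| = p^(n+m)`, generators `a, b` of
orders `p^n`, `p^m` with `b a b⁻¹ = a^r`.)  If `n - s ≥ m`, then
`ℚG ≅ ℚ ⊕ ⨁_{λ=1}^{m} (p^λ + p^(λ-1)) ℚ(ζ_{p^λ})
     ⊕ ⨁_{λ=m+1}^{n-s} p^m ℚ(ζ_{p^λ})
     ⊕ ⨁_{t=1}^{s} p^(m-t) M_{p^t}(ℚ(ζ_{p^(n-s)}))`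
as `ℚ`-algebras.  (The second factor is indexed by `λ = l+1` for `l : Fin m`,
the third by `λ = m+1+l` for `l : Fin (n-s-m)`, and the fourth by `t = j+1`
for `j : Fin s`.) -/
theorem stmt_0 (p n m s : ℕ) (r : ℤ) (hp : p.Prime) (hodd : Odd p)
    (hn : 2 ≤ n) (hm : 1 ≤ m) (hs1 : 1 ≤ s) (hsn : s ≤ n - 1) (hsm : s ≤ m)
    (hr : Int.gcd r (p ^ n) = 1) (hord : orderOf ((r : ZMod (p ^ n))) = p ^ s)
    (G : Type) [Group G] (a b : G)
    (hcard : Nat.card G = p ^ (n + m))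
    (ha : orderOf a = p ^ n) (hb : orderOf b = p ^ m)
    (hrel : b * a * b⁻¹ = a ^ r)
    (hgen : Subgroup.closure {a, b} = ⊤)
    (hcase : m ≤ n - s) :
    Nonempty
      (MonoidAlgebra ℚ G ≃ₐ[ℚ]
        ℚ ×
        ((l : Fin m) → Fin (p ^ (l.1 + 1) + p ^ l.1) →
          CyclotomicField (p ^ (l.1 + 1)) ℚ) ×
        ((l : Fin (n - s - m)) → Fin (p ^ m) →
          CyclotomicField (p ^ (m + 1 + l.1)) ℚ) ×
        ((j : Fin s) → Fin (p ^ (m - (j.1 + 1))) →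
          Matrix (Fin (p ^ (j.1 + 1))) (Fin (p ^ (j.1 + 1)))
            (CyclotomicField (p ^ (n - s)) ℚ))) := by
  have hpp := hp.pos
  obtain ⟨k, hk, hpk⟩ := r_arith' p n s r hp hodd hs1 hsn hord
  have hl : LiftProp a b (p ^ n) (p ^ m) (1 + p ^ (n - s) * k) :=
    liftProp_of _ _ _ (pow_pos hpp _) (pow_pos hpp _) (by rw [hcard, pow_add]) ha hb hrel hk hgen
  have : Finite G := Nat.finite_of_card_ne_zero (by rw [hcard]; exact (pow_pos hpp _).ne')
  have hns : n - s ≤ n := Nat.sub_le _ _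
  choose F1 hF1 using fun (l : Fin m) (i : Fin (p ^ (l.1 + 1) + p ^ l.1)) =>
    rep1 p n m (n - s) k hp hns hcase hl l.1 l.2 i.1 i.2
  choose F2 hF2 hF2b hF2c using fun (l : Fin (n - s - m)) (i : Fin (p ^ m)) =>
    rep2 p n m (n - s) k hp hns hl l.1 (by have := l.2; omega) i.1 i.2
  choose F3 hF3s hF3ab hF3o hF3o' hF3c hF3c' using
    fun (j : Fin s) (i : Fin (p ^ (m - (j.1 + 1)))) =>
    rep3 p n m s (n - s) k hp (by omega) hcase hsm hpk hl (j.1 + 1) (by omega)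
      (by have := j.2; omega) i.1 i.2
  let F0 : MonoidAlgebra ℚ G →ₐ[ℚ] ℚ := MonoidAlgebra.lift ℚ ℚ G 1
  have hF0 : ∀ g, ev F0 g = ev F0 1 := by
    intro g; simp [ev_apply, F0]
  have hF0s : Function.Surjective F0 := fun q => ⟨algebraMap ℚ _ q, by rw [AlgHom.commutes]; rfl⟩
  -- separation of kernels
  have s0A : ∀ {X : Type} [Ring X] [Algebra ℚ X] (L : ℕ) (F : MonoidAlgebra ℚ G →ₐ[ℚ] X),
      AbProp a b p L F → TwoSidedIdeal.ker F0 ≠ TwoSidedIdeal.ker F := by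
    intro X _ _ L F hF h
    exact hF.2.2.2.2 ⟨(ev_congr h _ _).1 (hF0 _), (ev_congr h _ _).1 (hF0 _)⟩
  have s03 : ∀ j i, TwoSidedIdeal.ker F0 ≠ TwoSidedIdeal.ker (F3 j i) := by
    intro j i h
    exact hF3ab j i ((ev_congr h _ _).1 ((hF0 _).trans (hF0 _).symm))
  have sA3 : ∀ {X : Type} [Ring X] [Algebra ℚ X] (L : ℕ) (F : MonoidAlgebra ℚ G →ₐ[ℚ] X),
      AbProp a b p L F → ∀ j i, TwoSidedIdeal.ker F ≠ TwoSidedIdeal.ker (F3 j i) := by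
    intro X _ _ L F hF j i h
    exact hF3ab j i ((ev_congr h _ _).1 hF.2.1)
  have s12 : ∀ l i l' i', TwoSidedIdeal.ker (F1 l i) ≠ TwoSidedIdeal.ker (F2 l' i') := by
    intro l i l' i' h
    have := abProp_level (hF1 l i).1 (hF2 l' i') h
    have := l.2
    omega
  have s11 : ∀ l i l' i', TwoSidedIdeal.ker (F1 l i) = TwoSidedIdeal.ker (F1 l' i') →
      (⟨l, i⟩ : Σ l : Fin m, Fin (p ^ (l.1 + 1) + p ^ l.1)) = ⟨l', i'⟩ := by
    intro l i l' i' h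
    have e1 := abProp_level (hF1 l i).1 (hF1 l' i').1 h
    have e2 := abProp_level (hF1 l' i').1 (hF1 l i).1 h.symm
    obtain rfl : l = l' := Fin.ext (by omega)
    obtain ⟨-, a1, a2⟩ := hF1 l i
    obtain ⟨-, b1, b2⟩ := hF1 l i'
    congr 1
    apply Fin.ext
    rcases lt_or_ge i.1 (p ^ (l.1 + 1)) with hi | hi <;>
      rcases lt_or_ge i'.1 (p ^ (l.1 + 1)) with hi' | hi'
    · exact (b1 hi').2 _ hi ((ev_congr h _ _).1 (a1 hi).1)
    · exact absurd ((ev_congr h _ _).1 (a1 hi).1) ((b2 hi').1 _)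
    · exact absurd ((ev_congr h _ _).2 (b1 hi').1) ((a2 hi).1 _)
    · have := (b2 hi').2.2 (i.1 - p ^ (l.1 + 1)) (by have := i.2; omega)
        ((ev_congr h _ _).1 (a2 hi).2.1)
      omega
  have s22 : ∀ l i l' i', TwoSidedIdeal.ker (F2 l i) = TwoSidedIdeal.ker (F2 l' i') →
      (⟨l, i⟩ : Σ _ : Fin (n - s - m), Fin (p ^ m)) = ⟨l', i'⟩ := by
    intro l i l' i' h
    have e1 := abProp_level (hF2 l i) (hF2 l' i') h
    have e2 := abProp_level (hF2 l' i') (hF2 l i) h.symm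
    obtain rfl : l = l' := Fin.ext (by omega)
    congr 1
    exact Fin.ext (hF2c l i' _ i.2 ((ev_congr h _ _).1 (hF2b l i)))
  have s33' : ∀ j i j' i', TwoSidedIdeal.ker (F3 j i) = TwoSidedIdeal.ker (F3 j' i') →
      j' ≤ j := by
    intro j i j' i' h
    by_contra hlt
    push Not at hlt
    rw [Fin.lt_def] at hlt
    apply hF3o' j' i'
    have h1 := (ev_congr h _ _).1 (hF3o j i)
    have e : p ^ (n - s + (j'.1 + 1) - 1) = p ^ (n - s + (j.1 + 1)) * p ^ (j'.1 - (j.1 + 1)) := by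
      rw [← pow_add]; congr 1; omega
    rw [e, pow_mul, map_pow, h1, map_one, one_pow]
  have s33 : ∀ j i j' i', TwoSidedIdeal.ker (F3 j i) = TwoSidedIdeal.ker (F3 j' i') →
      (⟨j, i⟩ : Σ j : Fin s, Fin (p ^ (m - (j.1 + 1)))) = ⟨j', i'⟩ := by
    intro j i j' i' h
    obtain rfl : j = j' := le_antisymm (s33' _ _ _ _ h.symm) (s33' _ _ _ _ h)
    congr 1
    exact Fin.ext (hF3c' j i' _ i.2 ((ev_congr h _ _).1 (hF3c j i)))
  let I : Unit ⊕ (Σ l : Fin m, Fin (p ^ (l.1 + 1) + p ^ l.1)) ⊕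
      (Σ _ : Fin (n - s - m), Fin (p ^ m)) ⊕ (Σ j : Fin s, Fin (p ^ (m - (j.1 + 1)))) →
      TwoSidedIdeal (MonoidAlgebra ℚ G) :=
    Sum.elim (fun _ => TwoSidedIdeal.ker F0)
      (Sum.elim (fun x => TwoSidedIdeal.ker (F1 x.1 x.2))
        (Sum.elim (fun x => TwoSidedIdeal.ker (F2 x.1 x.2))
          (fun x => TwoSidedIdeal.ker (F3 x.1 x.2))))
  have hImax : ∀ i, MaxLike (I i) := by
    rintro (_ | ⟨l, i⟩ | ⟨l, i⟩ | ⟨j, i⟩)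
    · exact maxLike_ker' F0 hF0s
    · exact maxLike_ker' (F1 l i) (hF1 l i).1.1
    · exact maxLike_ker' (F2 l i) (hF2 l i).1
    · have : Nonempty (Fin (p ^ (j.1 + 1))) := ⟨⟨0, pow_pos hpp _⟩⟩
      exact maxLike_ker' (F3 j i) (hF3s j i)
  have hIinj : Function.Injective I := by
    rintro (_ | ⟨l, i⟩ | ⟨l, i⟩ | ⟨j, i⟩) (_ | ⟨l', i'⟩ | ⟨l', i'⟩ | ⟨j', i'⟩) h
    · rfl
    · exact absurd h (s0A _ _ (hF1 l' i').1)
    · exact absurd h (s0A _ _ (hF2 l' i'))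
    · exact absurd h (s03 _ _)
    · exact absurd h.symm (s0A _ _ (hF1 l i).1)
    · rw [s11 _ _ _ _ h]
    · exact absurd h (s12 _ _ _ _)
    · exact absurd h (sA3 _ _ (hF1 l i).1 _ _)
    · exact absurd h.symm (s0A _ _ (hF2 l i))
    · exact absurd h.symm (s12 _ _ _ _)
    · rw [s22 _ _ _ _ h]
    · exact absurd h (sA3 _ _ (hF2 l i) _ _)
    · exact absurd h.symm (s03 _ _)
    · exact absurd h.symm (sA3 _ _ (hF1 l' i').1 _ _)
    · exact absurd h.symm (sA3 _ _ (hF2 l' i') _ _)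
    · rw [s33 _ _ _ _ h]
  let Φ := F0.prod ((AlgHom.pi fun l => AlgHom.pi fun i => F1 l i).prod
    ((AlgHom.pi fun l => AlgHom.pi fun i => F2 l i).prod
      (AlgHom.pi fun j => AlgHom.pi fun i => F3 j i)))
  have hsurj : Function.Surjective Φ := by
    rintro ⟨y0, y1, y2, y3⟩
    obtain ⟨x0, hx0⟩ := hF0s y0
    choose x1 hx1 using fun l i => (hF1 l i).1.1 (y1 l i)
    choose x2 hx2 using fun l i => (hF2 l i).1 (y2 l i)
    choose x3 hx3 using fun j i => hF3s j i (y3 j i)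
    obtain ⟨z, hz⟩ := crt_aux I hImax hIinj
      (Sum.elim (fun _ => x0) (Sum.elim (fun x => x1 x.1 x.2)
        (Sum.elim (fun x => x2 x.1 x.2) (fun x => x3 x.1 x.2))))
    have z0 := hz (Sum.inl ())
    have z1 := fun l i => hz (Sum.inr (Sum.inl ⟨l, i⟩))
    have z2 := fun l i => hz (Sum.inr (Sum.inr (Sum.inl ⟨l, i⟩)))
    have z3 := fun j i => hz (Sum.inr (Sum.inr (Sum.inr ⟨j, i⟩)))
    simp only [I, Sum.elim_inl, Sum.elim_inr, TwoSidedIdeal.mem_ker, map_sub, sub_eq_zero,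
      hx0, hx1, hx2, hx3] at z0 z1 z2 z3
    refine ⟨z, ?_⟩
    refine Prod.ext z0 (Prod.ext ?_ (Prod.ext ?_ ?_))
    · funext l i; exact z1 l i
    · funext l i; exact z2 l i
    · funext j i; exact z3 j i
  have cycdim : ∀ L, Module.finrank ℚ (CyclotomicField (p ^ L) ℚ) = (p ^ L).totient := by
    intro L
    have : NeZero (p ^ L) := ⟨(pow_pos hpp _).ne'⟩
    exact IsCyclotomicExtension.Rat.finrank (p ^ L) _
  have cycfin : ∀ L, Module.Finite ℚ (CyclotomicField (p ^ L) ℚ) := by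
    intro L
    have : NeZero (p ^ L) := ⟨(pow_pos hpp _).ne'⟩
    exact IsCyclotomicExtension.finiteDimensional {p ^ L} ℚ _
  have hdim : Module.finrank ℚ (MonoidAlgebra ℚ G) = Module.finrank ℚ (ℚ ×
        ((l : Fin m) → Fin (p ^ (l.1 + 1) + p ^ l.1) →
          CyclotomicField (p ^ (l.1 + 1)) ℚ) ×
        ((l : Fin (n - s - m)) → Fin (p ^ m) →
          CyclotomicField (p ^ (m + 1 + l.1)) ℚ) ×
        ((j : Fin s) → Fin (p ^ (m - (j.1 + 1))) →
          Matrix (Fin (p ^ (j.1 + 1))) (Fin (p ^ (j.1 + 1)))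
            (CyclotomicField (p ^ (n - s)) ℚ))) := by
    have hG : Module.finrank ℚ (MonoidAlgebra ℚ G) = p ^ (n + m) := by
      rw [← hcard]
      have := Fintype.ofFinite G
      rw [Nat.card_eq_fintype_card]
      exact (MonoidAlgebra.coeffLinearEquiv ℚ).finrank_eq.trans (Module.finrank_finsupp_self ℚ)
    have hd := dim_aux p m (n - s - m) s hp (by omega) hsm
    rw [show m + (n - s - m) + s + m = n + m by omega,
      show m + (n - s - m) = n - s by omega] at hd
    rw [hG, ← hd]
    have hmat : ∀ q L N : ℕ, Module.finrank ℚ (Fin q → Matrix (Fin N) (Fin N)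
        (CyclotomicField (p ^ L) ℚ)) = q * (N * N * (p ^ L).totient) := by
      intro q L N
      have h1 : Module.finrank ℚ (Matrix (Fin N) (Fin N) (CyclotomicField (p ^ L) ℚ))
          = N * N * (p ^ L).totient := by
        rw [Module.finrank_matrix, cycdim, Fintype.card_fin]
      have : Module.Finite ℚ (Matrix (Fin N) (Fin N) (CyclotomicField (p ^ L) ℚ)) :=
        Module.Finite.matrix
      rw [Module.finrank_pi_fintype, Finset.sum_const, h1, Finset.card_univ, Fintype.card_fin,
        smul_eq_mul]
    have hmfin : ∀ q L N : ℕ, Module.Finite ℚ (Fin q → Matrix (Fin N) (Fin N)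
        (CyclotomicField (p ^ L) ℚ)) := by
      intro q L N
      have : Module.Finite ℚ (Matrix (Fin N) (Fin N) (CyclotomicField (p ^ L) ℚ)) :=
        Module.Finite.matrix
      infer_instance
    simp only [Module.finrank_prod, Module.finrank_pi_fintype, hmat,
      Module.finrank_self, cycdim, Finset.sum_const, Finset.card_univ, Fintype.card_fin,
      smul_eq_mul]
  have : Module.Finite ℚ (MonoidAlgebra ℚ G) :=
    Module.Finite.equiv (MonoidAlgebra.coeffLinearEquiv (S := ℚ) (M := G) ℚ).symm
  have hinj : Function.Injective Φ :=
    (LinearMap.injective_iff_surjective_of_finrank_eq_finrank (f := Φ.toLinearMap) hdim).2 hsurj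
  exact ⟨AlgEquiv.ofBijective Φ ⟨hinj, hsurj⟩⟩
end

section
/- Let p be an odd prime and let G be the split metacyclic p-group G = ⟨a, b | a^(p^n) = b^(p^m) = 1, b a b⁻¹ = a^r⟩ with n ≥ 2, m ≥ 1, gcd(r, p^n) = 1 and r of multiplicative order p^s modulo p^n, 1 ≤ s ≤ min{n−1, m}. Suppose n − s < m and write m = (n − s) + k with k ≤ s. Then there is an isomorphism of ℚ-algebras ℚG ≅ ℚ ⊕ ⨁_{λ=1}^{n−s} (p^λ + p^{λ−1}) copies of ℚ(ζ_{p^λ}) ⊕ ⨁_{λ=n−s+1}^{m} p^{n−s} copies of ℚ(ζ_{p^λ}) ⊕ ⨁_{t=1}^{k−1} p^{n−s} copies of M_{p^t}(ℚ(ζ_{p^{n−s}})) ⊕ ⨁_{t=1}^{k−1} ⨁_{λ=n−s+1}^{m−t} (p^{n−s} − p^{n−s−1}) copies of M_{p^t}(ℚ(ζ_{p^λ})) ⊕ ⨁_{t=k}^{s} p^{m−t} copies of M_{p^t}(ℚ(ζ_{p^{n−s}})). -/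
set_option synthInstance.maxHeartbeats 1000000
set_option maxHeartbeats 1000000

namespace MetaW

/-! ### Chinese remainder theorem for simple quotients -/

lemma exists_sep_of_not_le {R B C : Type*} [Ring R] [Ring B] [Ring C] [IsSimpleRing B]
    (f : R →+* B) (g : R →+* C) (hf : Function.Surjective f)
    (x : R) (hx : g x = 0) (hx' : f x ≠ 0) : ∃ e, f e = 1 ∧ g e = 0 := by
  let J : TwoSidedIdeal B := TwoSidedIdeal.mk' {y | ∃ z, g z = 0 ∧ f z = y}
    ⟨0, by simp, by simp⟩
    (by rintro _ _ ⟨z, hz, rfl⟩ ⟨w, hw, rfl⟩; exact ⟨z + w, by simp [hz, hw], by simp⟩)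
    (by rintro _ ⟨z, hz, rfl⟩; exact ⟨-z, by simp [hz], by simp⟩)
    (by
      rintro c _ ⟨z, hz, rfl⟩
      obtain ⟨c, rfl⟩ := hf c
      exact ⟨c * z, by simp [hz], by simp⟩)
    (by
      rintro _ c ⟨z, hz, rfl⟩
      obtain ⟨c, rfl⟩ := hf c
      exact ⟨z * c, by simp [hz], by simp⟩)
  have hJ : ∀ y, y ∈ J ↔ ∃ z, g z = 0 ∧ f z = y := by
    intro y
    simp only [J, TwoSidedIdeal.mem_mk']
    rfl
  have htop : J = ⊤ := by
    rcases eq_bot_or_eq_top J with h | h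
    · exfalso
      apply hx'
      have : f x ∈ J := (hJ _).2 ⟨x, hx, rfl⟩
      rw [h] at this
      simpa using this
    · exact h
  have h1 : (1 : B) ∈ J := by rw [htop]; trivial
  obtain ⟨e, he, he'⟩ := (hJ _).1 h1
  exact ⟨e, he', he⟩

lemma exists_sep {R B C : Type*} [Ring R] [Ring B] [Ring C] [IsSimpleRing B] [IsSimpleRing C]
    (f : R →+* B) (g : R →+* C) (hf : Function.Surjective f) (hg : Function.Surjective g)
    (h : ∃ x, ¬ (f x = 0 ↔ g x = 0)) : ∃ e, f e = 1 ∧ g e = 0 := by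
  obtain ⟨x, hx⟩ := h
  by_cases h1 : g x = 0
  · exact exists_sep_of_not_le f g hf x h1 (fun h => hx (by simp [h, h1]))
  · have h2 : f x = 0 := by
      by_contra h2
      exact hx (by simp [h1, h2])
    obtain ⟨e, he, he'⟩ := exists_sep_of_not_le g f hg x h2 h1
    exact ⟨1 - e, by simp [he'], by simp [he]⟩

lemma pi_surjective {R ι : Type*} [Finite ι] [Ring R] {B : ι → Type*} [∀ i, Ring (B i)]
    [∀ i, IsSimpleRing (B i)] (f : ∀ i, R →+* B i) (hf : ∀ i, Function.Surjective (f i))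
    (h : ∀ i j, (∀ x, f i x = 0 ↔ f j x = 0) → i = j) :
    Function.Surjective (fun x i => f i x) := by
  classical
  cases nonempty_fintype ι
  have key : ∀ i, ∃ e, f i e = 1 ∧ ∀ j, j ≠ i → f j e = 0 := by
    intro i
    have : ∀ S : Finset ι, i ∉ S → ∃ e, f i e = 1 ∧ ∀ j ∈ S, f j e = 0 := by
      intro S
      induction S using Finset.induction_on with
      | empty => intro _; exact ⟨1, by simp, by simp⟩
      | insert j S hj ih =>
        intro hi
        simp only [Finset.mem_insert, not_or] at hi
        obtain ⟨e, he, he'⟩ := ih hi.2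
        obtain ⟨e2, h2, h2'⟩ := exists_sep (f i) (f j) (hf i) (hf j) (by
          by_contra hc
          push Not at hc
          exact hi.1 (h i j hc))
        refine ⟨e * e2, by simp [he, h2], ?_⟩
        intro j' hj'
        rcases Finset.mem_insert.1 hj' with rfl | hj'
        · simp [h2']
        · simp [he' j' hj']
    obtain ⟨e, he, he'⟩ := this (Finset.univ.erase i) (by simp)
    exact ⟨e, he, fun j hj => he' j (by simp [hj])⟩
  choose e he he' using key
  intro y
  choose c hc using fun i => hf i (y i)
  refine ⟨∑ i, c i * e i, ?_⟩
  funext j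
  simp only [map_sum, map_mul]
  rw [Finset.sum_eq_single j]
  · simp [hc, he]
  · intro i _ hi
    simp [he' i j hi.symm]
  · simp

/-! ### Number theory -/

lemma geom_dvd_iff {p : ℕ} (hp : p.Prime) (hodd : Odd p) (Q : ℕ) (hQ0 : 1 ≤ Q)
    (hQ : p ∣ Q - 1) (c v : ℕ) :
    p ^ c ∣ ∑ i ∈ Finset.range v, Q ^ i ↔ p ^ c ∣ v := by
  have := Fact.mk hp
  rcases Nat.eq_or_lt_of_le hQ0 with h1 | h1
  · subst h1; simp
  rcases Nat.eq_zero_or_pos v with rfl | hv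
  · simp
  have hpQ : ¬ p ∣ Q := by
    intro h
    have : p ∣ 1 := by
      have := (Nat.dvd_sub h hQ)
      rwa [Nat.sub_sub_self hQ0] at this
    exact hp.one_lt.ne' (Nat.dvd_one.1 this)
  have hval := padicValNat.pow_sub_pow hodd h1 hQ hpQ hv.ne'
  have hS : (∑ i ∈ Finset.range v, Q ^ i) ≠ 0 := by
    have : Q ^ 0 ≤ ∑ i ∈ Finset.range v, Q ^ i :=
      Finset.single_le_sum (f := fun i => Q ^ i) (fun _ _ => Nat.zero_le _)
        (Finset.mem_range.2 hv)
    simp at this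
    omega
  have hmul : (∑ i ∈ Finset.range v, Q ^ i) * (Q - 1) = Q ^ v - 1 ^ v := by
    have := Nat.geomSum_eq (m := Q) (by omega) v
    rw [this, one_pow, Nat.div_mul_cancel]
    simpa using Nat.sub_dvd_pow_sub_pow Q 1 v
  rw [← hmul, padicValNat.mul hS (by omega), add_comm] at hval
  have hval' : padicValNat p (∑ i ∈ Finset.range v, Q ^ i) = padicValNat p v := by omega
  rw [padicValNat_dvd_iff_le hS, padicValNat_dvd_iff_le hv.ne', hval']

lemma pow_sub_one_dvd_iff {p : ℕ} (hp : p.Prime) (hodd : Odd p) (N u : ℕ) (hN : 1 ≤ N)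
    (hu : ¬ p ∣ u) (c v : ℕ) :
    p ^ (N + c) ∣ (1 + p ^ N * u) ^ v - 1 ↔ p ^ c ∣ v := by
  have hu0 : 0 < u := Nat.pos_of_ne_zero (by rintro rfl; simp at hu)
  have hpN : 0 < p ^ N := pow_pos hp.pos _
  rw [← geom_dvd_iff hp hodd (1 + p ^ N * u) (by omega)
    (by simpa using (dvd_pow_self p (by omega : N ≠ 0)).mul_right u) c v]
  have h2 : 2 ≤ 1 + p ^ N * u := by nlinarith
  have hmul : (∑ i ∈ Finset.range v, (1 + p ^ N * u) ^ i) * (p ^ N * u)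
      = (1 + p ^ N * u) ^ v - 1 := by
    have := Nat.geomSum_eq h2 v
    have h3 : 1 + p ^ N * u - 1 = p ^ N * u := by omega
    rw [h3] at this
    rw [this, Nat.div_mul_cancel]
    have := Nat.sub_dvd_pow_sub_pow (1 + p ^ N * u) 1 v
    rwa [h3, one_pow] at this
  rw [← hmul, pow_add, mul_comm (p ^ N), mul_comm (p ^ N) u, ← mul_assoc,
    Nat.mul_dvd_mul_iff_right hpN]
  exact ((Nat.Coprime.pow_left c ((Nat.Prime.coprime_iff_not_dvd hp).2 hu))).dvd_mul_right

lemma exists_R {p n s : ℕ} {r : ℤ} (hp : p.Prime) (hodd : Odd p) (hs1 : 1 ≤ s)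
    (hsn : s ≤ n - 1) (hord : orderOf ((r : ZMod (p ^ n))) = p ^ s) :
    ∃ u : ℕ, ¬ p ∣ u ∧ ((1 + p ^ (n - s) * u : ℕ) : ZMod (p ^ n)) = r := by
  have := Fact.mk hp
  have hpn : 1 < p ^ n := Nat.one_lt_pow (by omega) hp.one_lt
  have : Fact (1 < p ^ n) := ⟨hpn⟩
  have : NeZero (p ^ n) := ⟨by omega⟩
  set R := ((r : ZMod (p ^ n))).val with hR
  have hRr : ((R : ℕ) : ZMod (p ^ n)) = r := by rw [hR, ZMod.natCast_zmod_val]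
  have hps : 1 < p ^ s := Nat.one_lt_pow (by omega) hp.one_lt
  have hR0 : R ≠ 0 := by
    intro h
    rw [h] at hRr
    rw [← hRr] at hord
    simp at hord
    omega
  have hR1 : R ≠ 1 := by
    intro h
    rw [h] at hRr
    rw [← hRr] at hord
    simp at hord
    omega
  have hpow : ∀ v, p ^ n ∣ R ^ v - 1 ↔ p ^ s ∣ v := by
    intro v
    rw [← hord, orderOf_dvd_iff_pow_eq_one, ← hRr, ← Nat.modEq_iff_dvd' (Nat.one_le_pow _ _ (by omega)),
      ← ZMod.natCast_eq_natCast_iff, eq_comm]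
    push_cast
    rfl
  have hpR : p ∣ R - 1 := by
    have h1 : p ∣ R ^ p ^ s - 1 := (dvd_pow_self p (by omega)).trans ((hpow _).2 dvd_rfl)
    rw [← Nat.modEq_iff_dvd' (Nat.one_le_pow _ _ (by omega)), ← ZMod.natCast_eq_natCast_iff] at h1
    rw [← Nat.modEq_iff_dvd' (by omega), ← ZMod.natCast_eq_natCast_iff]
    rw [h1]
    push_cast
    rw [ZMod.pow_card_pow]
  have hnpR : ¬ p ∣ R := by
    intro h
    have : p ∣ 1 := by
      have := (Nat.dvd_sub h hpR)
      rwa [Nat.sub_sub_self (by omega)] at this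
    exact hp.one_lt.ne' (Nat.dvd_one.1 this)
  have hval : ∀ c, padicValNat p (R ^ p ^ c - 1) = padicValNat p (R - 1) + c := by
    intro c
    have := padicValNat.pow_sub_pow hodd (x := R) (y := 1) (by omega) hpR hnpR
      (n := p ^ c) (pow_ne_zero _ hp.ne_zero)
    rw [one_pow] at this
    rw [this, padicValNat.prime_pow]
  have hne : ∀ c, R ^ p ^ c - 1 ≠ 0 := by
    intro c
    have : 1 < R ^ p ^ c := Nat.one_lt_pow (pow_ne_zero _ hp.ne_zero) (by omega)
    omega
  have h1 : n ≤ padicValNat p (R - 1) + s := by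
    rw [← hval, ← padicValNat_dvd_iff_le (hne s)]
    exact (hpow _).2 dvd_rfl
  have h2 : ¬ n ≤ padicValNat p (R - 1) + (s - 1) := by
    rw [← hval, ← padicValNat_dvd_iff_le (hne _), hpow,
      Nat.pow_dvd_pow_iff_le_right hp.one_lt]
    omega
  have h3 : padicValNat p (R - 1) = n - s := by omega
  have h4 : p ^ (n - s) ∣ R - 1 := by rw [padicValNat_dvd_iff_le (by omega), h3]
  have h5 : ¬ p ^ (n - s + 1) ∣ R - 1 := by rw [padicValNat_dvd_iff_le (by omega), h3]; omega
  obtain ⟨u, hu⟩ := h4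
  refine ⟨u, ?_, ?_⟩
  · rintro ⟨w, rfl⟩
    apply h5
    rw [hu, pow_succ]
    exact Dvd.intro w (by ring)
  · rw [← hRr, ← hu]
    congr 1
    omega

end MetaW

namespace MetaW

/-! ### The group -/

lemma pow_mul_pow_of_rel {M : Type*} [Monoid M] {A B : M} {R : ℕ} (h : B * A = A ^ R * B)
    (i j : ℕ) : B ^ j * A ^ i = A ^ (i * R ^ j) * B ^ j := by
  have h1 : ∀ i, B * A ^ i = A ^ (i * R) * B := by
    intro i
    induction i with
    | zero => simp
    | succ i ih =>
      rw [pow_succ, ← mul_assoc, ih, mul_assoc, h, ← mul_assoc, ← pow_add]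
      congr 2; ring
  induction j generalizing i with
  | zero => simp
  | succ j ih =>
    rw [pow_succ, mul_assoc, h1, ← mul_assoc, ih, mul_assoc, ← pow_succ]
    congr 2; ring

lemma mul_pow_of_rel {M : Type*} [Monoid M] {A B : M} {R : ℕ} (h : B * A = A ^ R * B)
    (l i v : ℕ) : (A ^ l * B ^ i) ^ v
      = A ^ (l * ∑ c ∈ Finset.range v, (R ^ i) ^ c) * B ^ (i * v) := by
  induction v with
  | zero => simp
  | succ v ih =>
    rw [pow_succ, ih, mul_assoc, ← mul_assoc (B ^ (i * v)), pow_mul_pow_of_rel h, mul_assoc,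
      ← pow_add, ← mul_assoc, ← pow_add, Finset.sum_range_succ]
    congr 2
    rw [← pow_mul]; ring

lemma pow_congr_mod {M : Type*} [Monoid M] {A : M} {q u v : ℕ} (hA : A ^ q = 1)
    (h : u ≡ v [MOD q]) : A ^ u = A ^ v := by
  rw [← Nat.mod_add_div u q, ← Nat.mod_add_div v q, pow_add, pow_mul, hA, pow_add, pow_mul, hA, h]
  simp

variable {G : Type*} [Group G]

/-- The data of a split metacyclic group with natural number parameters. -/
structure Meta (q1 q2 R : ℕ) (a b : G) : Prop where
  q1pos : 0 < q1
  q2pos : 0 < q2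
  ha : a ^ q1 = 1
  hb : b ^ q2 = 1
  hba : b * a = a ^ R * b
  hcard : Nat.card G = q1 * q2
  hgen : Subgroup.closure {a, b} = ⊤

variable {q1 q2 R : ℕ} {a b : G}

lemma Meta.inv_a (h : Meta q1 q2 R a b) : a⁻¹ = a ^ (q1 - 1) := by
  have := h.q1pos
  rw [inv_eq_iff_mul_eq_one, ← pow_succ', Nat.sub_add_cancel this, h.ha]

lemma Meta.inv_b (h : Meta q1 q2 R a b) : b⁻¹ = b ^ (q2 - 1) := by
  have := h.q2pos
  rw [inv_eq_iff_mul_eq_one, ← pow_succ', Nat.sub_add_cancel this, h.hb]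

lemma Meta.exists_form (h : Meta q1 q2 R a b) (g : G) : ∃ u v : ℕ, g = a ^ u * b ^ v := by
  have hA : ∀ (i u v : ℕ), ∃ u' v' : ℕ, a ^ i * (a ^ u * b ^ v) = a ^ u' * b ^ v' :=
    fun i u v => ⟨i + u, v, by rw [pow_add, mul_assoc]⟩
  have hB : ∀ (i u v : ℕ), ∃ u' v' : ℕ, b ^ i * (a ^ u * b ^ v) = a ^ u' * b ^ v' :=
    fun i u v => ⟨u * R ^ i, i + v, by
      rw [← mul_assoc, pow_mul_pow_of_rel h.hba, mul_assoc, ← pow_add]⟩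
  have hg : g ∈ Subgroup.closure {a, b} := by rw [h.hgen]; trivial
  induction hg using Subgroup.closure_induction_left with
  | one => exact ⟨0, 0, by simp⟩
  | mul_left x hx y hy ih =>
    obtain ⟨u, v, rfl⟩ := ih
    rcases hx with rfl | hx
    · simpa using hA 1 u v
    · rw [Set.mem_singleton_iff] at hx; subst hx; simpa using hB 1 u v
  | inv_mul_cancel x hx y hy ih =>
    obtain ⟨u, v, rfl⟩ := ih
    rcases hx with rfl | hx
    · rw [h.inv_a]; exact hA _ u v
    · rw [Set.mem_singleton_iff] at hx; subst hx; rw [h.inv_b]; exact hB _ u v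

lemma Meta.form_unique (h : Meta q1 q2 R a b) {u v u' v' : ℕ}
    (he : a ^ u * b ^ v = a ^ u' * b ^ v') : u ≡ u' [MOD q1] ∧ v ≡ v' [MOD q2] := by
  have h1 := h.q1pos
  have h2 := h.q2pos
  have hfin : Finite G := Nat.finite_of_card_ne_zero (by rw [h.hcard]; positivity)
  let f : Fin q1 × Fin q2 → G := fun x => a ^ x.1.1 * b ^ x.2.1
  have hf : Function.Surjective f := by
    intro g
    obtain ⟨u, v, rfl⟩ := h.exists_form g
    refine ⟨(⟨u % q1, Nat.mod_lt _ h1⟩, ⟨v % q2, Nat.mod_lt _ h2⟩), ?_⟩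
    simp only [f]
    rw [pow_congr_mod h.ha (Nat.mod_modEq u q1), pow_congr_mod h.hb (Nat.mod_modEq v q2)]
  have hbij : Function.Bijective f := by
    rw [Nat.bijective_iff_surjective_and_card]
    exact ⟨hf, by simp [h.hcard]⟩
  have := @hbij.1 (⟨u % q1, Nat.mod_lt _ h1⟩, ⟨v % q2, Nat.mod_lt _ h2⟩)
    (⟨u' % q1, Nat.mod_lt _ h1⟩, ⟨v' % q2, Nat.mod_lt _ h2⟩) (by
      simp only [f]
      rw [pow_congr_mod h.ha (Nat.mod_modEq u q1), pow_congr_mod h.hb (Nat.mod_modEq v q2),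
        pow_congr_mod h.ha (Nat.mod_modEq u' q1), pow_congr_mod h.hb (Nat.mod_modEq v' q2), he])
  simpa [Nat.ModEq] using this

lemma Meta.lift (h : Meta q1 q2 R a b) {M : Type*} [Monoid M] (A B : M)
    (hA : A ^ q1 = 1) (hB : B ^ q2 = 1) (hBA : B * A = A ^ R * B) :
    ∃ ρ : G →* M, ρ a = A ∧ ρ b = B := by
  choose u v huv using h.exists_form
  have key : ∀ i j, A ^ (u (a ^ i * b ^ j)) * B ^ (v (a ^ i * b ^ j)) = A ^ i * B ^ j := by
    intro i j
    obtain ⟨h1, h2⟩ := h.form_unique (huv (a ^ i * b ^ j))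
    rw [pow_congr_mod hA h1, pow_congr_mod hB h2]
  refine ⟨⟨⟨fun g => A ^ u g * B ^ v g, ?_⟩, ?_⟩, ?_, ?_⟩
  · simpa using key 0 0
  · intro x y
    have : x * y = a ^ (u x + u y * R ^ v x) * b ^ (v x + v y) := by
      conv_lhs => rw [huv x, huv y]
      rw [mul_assoc, ← mul_assoc (b ^ _), pow_mul_pow_of_rel h.hba, mul_assoc, ← pow_add,
        ← mul_assoc, ← pow_add]
    dsimp only
    rw [this, key, mul_assoc, ← mul_assoc (B ^ _), pow_mul_pow_of_rel hBA, mul_assoc, ← pow_add,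
        ← mul_assoc, ← pow_add]
  · simpa using key 1 0
  · simpa using key 0 1

/-- factorization `G = ⟨a⟩⟨a^l b⟩`. -/
lemma Meta.factA (h : Meta q1 q2 R a b) (l : ℕ) (g : G) :
    ∃ u v : ℕ, g = a ^ u * (a ^ l * b) ^ v := by
  obtain ⟨u, v, rfl⟩ := h.exists_form g
  have hx := mul_pow_of_rel h.hba l 1 v
  simp only [pow_one, one_mul] at hx
  refine ⟨u + (q1 - 1) * (l * ∑ c ∈ Finset.range v, R ^ c), v, ?_⟩
  rw [hx, ← mul_assoc, ← pow_add, add_assoc, ← Nat.succ_mul, Nat.succ_eq_add_one,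
    Nat.sub_add_cancel h.q1pos, pow_add, pow_mul a q1, h.ha, one_pow, mul_one]

/-- factorization `G = ⟨b⟩⟨a^l b^i⟩`. -/
lemma factB {p n : ℕ} (hp : p.Prime) (hodd : Odd p) (h : Meta (p ^ n) q2 R a b)
    (hR : p ∣ R - 1) (hR1 : 1 ≤ R) (l i : ℕ) (hl : l.Coprime p) (g : G) :
    ∃ u v : ℕ, g = b ^ u * (a ^ l * b ^ i) ^ v := by
  have hpn := h.q1pos
  have hq2 := h.q2pos
  have hQ1 : 1 ≤ R ^ i := Nat.one_le_pow _ _ hR1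
  have hQ : p ∣ R ^ i - 1 := hR.trans (by simpa using Nat.sub_dvd_pow_sub_pow R 1 i)
  have hQp : (R ^ i).Coprime p := by
    rw [Nat.coprime_comm, Nat.Prime.coprime_iff_not_dvd hp]
    intro h
    have : p ∣ 1 := by
      have := (Nat.dvd_sub h hQ)
      rwa [Nat.sub_sub_self hQ1] at this
    exact hp.one_lt.ne' (Nat.dvd_one.1 this)
  set x := a ^ l * b ^ i with hx
  have hxv := mul_pow_of_rel h.hba l i
  -- surjectivity of the geometric sums
  let f : Fin (p ^ n) → Fin (p ^ n) := fun v =>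
    ⟨(l * ∑ c ∈ Finset.range v.1, (R ^ i) ^ c) % p ^ n, Nat.mod_lt _ hpn⟩
  have hinj : Function.Injective f := by
    have aux : ∀ v w : Fin (p ^ n), v.1 ≤ w.1 → f v = f w → v = w := by
      intro v w hvw hfe
      have h1 : (l * ∑ c ∈ Finset.range v.1, (R ^ i) ^ c)
          ≡ (l * ∑ c ∈ Finset.range w.1, (R ^ i) ^ c) [MOD p ^ n] := by
        simpa [f, Nat.ModEq] using hfe
      have h2 := Nat.ModEq.cancel_left_of_coprime (Nat.Coprime.gcd_eq_one
        (Nat.Coprime.pow_left n hl.symm)) h1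
      obtain ⟨d, hd⟩ := Nat.exists_eq_add_of_le hvw
      rw [hd, Finset.sum_range_add] at h2
      have h3 : 0 ≡ ∑ c ∈ Finset.range d, (R ^ i) ^ (v.1 + c) [MOD p ^ n] := by
        apply Nat.ModEq.add_left_cancel' (∑ c ∈ Finset.range v.1, (R ^ i) ^ c)
        simpa using h2
      have h4 : p ^ n ∣ (R ^ i) ^ v.1 * ∑ c ∈ Finset.range d, (R ^ i) ^ c := by
        rw [Finset.mul_sum]
        simp_rw [← pow_add]
        exact (Nat.modEq_zero_iff_dvd).1 h3.symm
      have h5 : p ^ n ∣ ∑ c ∈ Finset.range d, (R ^ i) ^ c :=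
        (Nat.Coprime.pow _ _ hQp.symm).dvd_of_dvd_mul_left h4
      rw [geom_dvd_iff hp hodd _ hQ1 hQ] at h5
      have h6 : d = 0 := Nat.eq_zero_of_dvd_of_lt h5 (by have := w.2; omega)
      ext; omega
    intro v w hvw
    rcases le_total v.1 w.1 with h1 | h1
    · exact aux v w h1 hvw
    · exact (aux w v h1 hvw.symm).symm
  have hsurj : Function.Surjective f := Finite.surjective_of_injective hinj
  have hform : ∀ g : G, ∃ v u : ℕ, g = x ^ v * b ^ u := by
    intro g
    obtain ⟨u, v, rfl⟩ := h.exists_form g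
    obtain ⟨c, hc⟩ := hsurj ⟨u % p ^ n, Nat.mod_lt _ hpn⟩
    have hc' : l * ∑ c ∈ Finset.range c.1, (R ^ i) ^ c ≡ u [MOD p ^ n] := by
      simpa [f, Nat.ModEq] using hc
    refine ⟨c.1, (q2 - 1) * (i * c.1) + v, ?_⟩
    have h7 : i * c.1 + (q2 - 1) * (i * c.1) = q2 * (i * c.1) := by
      obtain ⟨q, rfl⟩ : ∃ q, q2 = q + 1 := ⟨q2 - 1, by omega⟩
      simp only [Nat.add_sub_cancel]
      ring
    rw [hxv, pow_congr_mod h.ha hc', mul_assoc, ← pow_add, ← add_assoc, h7, pow_add, pow_mul b q2, h.hb, one_pow, one_mul]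
  obtain ⟨v, u, hg⟩ := hform g⁻¹
  have hfin : Finite G := Nat.finite_of_card_ne_zero (by rw [h.hcard]; positivity)
  have hxo : ∀ y : G, ∃ w : ℕ, y⁻¹ = y ^ w := by
    intro y
    have := Nat.card_pos (α := G)
    refine ⟨Nat.card G - 1, ?_⟩
    rw [inv_eq_iff_mul_eq_one, ← pow_succ', Nat.sub_add_cancel this, pow_card_eq_one']
  obtain ⟨w1, hw1⟩ := hxo b
  obtain ⟨w2, hw2⟩ := hxo x
  refine ⟨w1 * u, w2 * v, ?_⟩
  rw [pow_mul, pow_mul, ← hw1, ← hw2, inv_pow, inv_pow, ← mul_inv_rev, ← hg, inv_inv]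

end MetaW

namespace MetaW

/-! ### Descent of an absolutely irreducible representation -/

theorem descent {F E V G : Type*} [Field F] [Field E] [Algebra F E] [AddCommGroup V] [Module E V]
    [FiniteDimensional E V] [Group G] (d : ℕ) (hd : 0 < d) (hV : Module.finrank E V = d)
    (ρ : G →* Module.End E V) (hspan : Submodule.span E (Set.range ρ) = ⊤) (x y : G)
    (hxy : ∀ g, ∃ u v : ℕ, g = y ^ u * x ^ v) (hx : (ρ x) ^ d = 1) (η : F)
    (hy : (ρ y) ^ d = algebraMap F E η • 1) :
    ∃ ρF : G →* Matrix (Fin d) (Fin d) F, Submodule.span F (Set.range ρF) = ⊤ ∧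
      ∀ (g : G) (c : F), ρ g = algebraMap F E c • 1 → ρF g = c • 1 := by
  classical
  have hypow : ∀ u : ℕ, (ρ y) ^ u = algebraMap F E (η ^ (u / d)) • (ρ y) ^ (u % d) := by
    intro u
    conv_lhs => rw [← Nat.div_add_mod u d, pow_add, pow_mul, hy]
    rw [smul_pow, one_pow, smul_mul_assoc, one_mul, map_pow]
  let fam : Fin d × Fin d → Module.End E V := fun z => (ρ y) ^ z.1.1 * (ρ x) ^ z.2.1
  have hfam_span : ⊤ ≤ Submodule.span E (Set.range fam) := by
    rw [← hspan, Submodule.span_le]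
    rintro _ ⟨g, rfl⟩
    obtain ⟨u, v, rfl⟩ := hxy g
    rw [map_mul, map_pow, map_pow, hypow, pow_congr_mod hx (Nat.mod_modEq v d).symm,
      smul_mul_assoc]
    exact Submodule.smul_mem _ _ (Submodule.subset_span
      ⟨(⟨u % d, Nat.mod_lt _ hd⟩, ⟨v % d, Nat.mod_lt _ hd⟩), rfl⟩)
  have hcardE : Fintype.card (Fin d × Fin d) = Module.finrank E (Module.End E V) := by
    rw [Module.finrank_linearMap, hV]
    simp
  have hfam : LinearIndependent E fam :=
    linearIndependent_of_top_le_span_of_card_eq_finrank hfam_span hcardE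
  -- a vector fixed by `x`
  have hne : ∑ v ∈ Finset.range d, (ρ x) ^ v ≠ 0 := by
    intro h0
    rw [Finset.sum_range] at h0
    have hli : LinearIndependent E (fun v : Fin d => (ρ x) ^ v.1) := by
      have := hfam.comp (fun v : Fin d => ((⟨0, hd⟩ : Fin d), v)) (fun a b h => by simpa using h)
      simpa [fam, Function.comp_def] using this
    rw [Fintype.linearIndependent_iff] at hli
    have := hli (fun _ => 1) (by simpa using h0) ⟨0, hd⟩
    exact one_ne_zero this
  obtain ⟨w0, hw0⟩ : ∃ w0, (∑ v ∈ Finset.range d, (ρ x) ^ v) w0 ≠ 0 := by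
    by_contra hc
    push Not at hc
    exact hne (LinearMap.ext hc)
  obtain ⟨w, hw⟩ : ∃ w, w = (∑ v ∈ Finset.range d, (ρ x) ^ v) w0 := ⟨_, rfl⟩
  rw [← hw] at hw0
  have hxw : ρ x w = w := by
    have := mul_geom_sum (ρ x) d
    rw [hx, sub_self] at this
    have h2 := LinearMap.congr_fun this w0
    rw [Module.End.mul_apply, ← hw] at h2
    simpa [sub_eq_zero] using h2
  have hxvw : ∀ v : ℕ, ((ρ x) ^ v) w = w := by
    intro v
    induction v with
    | zero => simp
    | succ v ih => rw [pow_succ, Module.End.mul_apply, hxw, ih]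
  let e : Fin d → V := fun u => ((ρ y) ^ u.1) w
  have hgw : ∀ g : G, ∃ (c : F) (i : Fin d), ρ g w = algebraMap F E c • e i := by
    intro g
    obtain ⟨u, v, rfl⟩ := hxy g
    refine ⟨η ^ (u / d), ⟨u % d, Nat.mod_lt _ hd⟩, ?_⟩
    rw [map_mul, map_pow, map_pow, Module.End.mul_apply, hxvw, hypow]
    rfl
  choose cf idx hci using hgw
  have he_span : ⊤ ≤ Submodule.span E (Set.range e) := by
    intro v _
    obtain ⟨f, hf⟩ : ∃ f : Module.Dual E V, f w ≠ 0 := by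
      by_contra hc
      push Not at hc
      exact hw0 ((Module.forall_dual_apply_eq_zero_iff E w).1 hc)
    have hT : ∀ T ∈ Submodule.span E (Set.range ρ), T w ∈ Submodule.span E (Set.range e) := by
      intro T hT
      induction hT using Submodule.span_induction with
      | mem T hT =>
        obtain ⟨g, rfl⟩ := hT
        rw [hci]
        exact Submodule.smul_mem _ _ (Submodule.subset_span ⟨_, rfl⟩)
      | zero => simp
      | add S T _ _ hS hT => exact Submodule.add_mem _ hS hT
      | smul c T _ hT => exact Submodule.smul_mem _ _ hT
    have := hT ((f w)⁻¹ • f.smulRight v) (by rw [hspan]; trivial)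
    simpa [smul_smul, inv_mul_cancel₀ hf] using this
  have he_li : LinearIndependent E e :=
    linearIndependent_of_top_le_span_of_card_eq_finrank he_span (by simp [hV])
  let Bs : Module.Basis (Fin d) E V := Module.Basis.mk he_li he_span
  have hBs : ∀ i, Bs i = e i := fun i => by simp [Bs]
  let MF : G → Matrix (Fin d) (Fin d) F := fun g =>
    Matrix.of fun i j => if i = idx (g * y ^ j.1) then cf (g * y ^ j.1) else 0
  have hMF : ∀ g, (MF g).map (algebraMap F E) = LinearMap.toMatrix Bs Bs (ρ g) := by
    intro g
    ext i j
    have h1 : ρ g (Bs j) = algebraMap F E (cf (g * y ^ j.1)) • Bs (idx (g * y ^ j.1)) := by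
      rw [hBs, hBs, ← hci, map_mul, map_pow, Module.End.mul_apply]
    rw [LinearMap.toMatrix_apply, h1, map_smul, Module.Basis.repr_self]
    simp only [Matrix.map_apply, MF, Matrix.of_apply, Finsupp.smul_apply, Finsupp.single_apply,
      smul_eq_mul, eq_comm (a := i)]
    split_ifs <;> simp
  have hinj : Function.Injective
      (fun M : Matrix (Fin d) (Fin d) F => M.map (algebraMap F E)) :=
    Matrix.map_injective (algebraMap F E).injective
  let ρF : G →* Matrix (Fin d) (Fin d) F :=
    { toFun := MF
      map_one' := by
        apply hinj
        simp only
        rw [hMF, map_one, LinearMap.toMatrix_one]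
        simp
      map_mul' := by
        intro g h
        apply hinj
        simp only
        rw [hMF, map_mul, LinearMap.toMatrix_mul, Matrix.map_mul, hMF, hMF] }
  have hρF : ∀ g, (ρF g).map (algebraMap F E) = LinearMap.toMatrix Bs Bs (ρ g) := hMF
  refine ⟨ρF, ?_, ?_⟩
  · let famF : Fin d × Fin d → Matrix (Fin d) (Fin d) F := fun z => ρF (y ^ z.1.1 * x ^ z.2.1)
    have hli : LinearIndependent F famF := by
      rw [Fintype.linearIndependent_iff]
      intro c hc i
      have h1 : ∑ z, algebraMap F E (c z) • fam z = 0 := by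
        apply (LinearMap.toMatrix Bs Bs).injective
        rw [map_sum, map_zero]
        have h2 := congrArg (fun M : Matrix (Fin d) (Fin d) F => (algebraMap F E).mapMatrix M) hc
        simp only [map_sum, map_zero] at h2
        rw [← h2]
        refine Finset.sum_congr rfl fun z _ => ?_
        rw [map_smul]
        have : (algebraMap F E).mapMatrix (famF z) = LinearMap.toMatrix Bs Bs (fam z) := by
          simp only [famF, fam, RingHom.mapMatrix_apply]
          rw [hρF, map_mul, map_pow, map_pow]
        rw [← this]
        ext i j
        simp
      have h3 := (Fintype.linearIndependent_iff.1 hfam) _ h1 i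
      simpa using h3
    rw [eq_top_iff, ← hli.span_eq_top_of_card_eq_finrank' (by simp [Module.finrank_matrix])]
    apply Submodule.span_mono
    rintro _ ⟨z, rfl⟩
    exact ⟨_, rfl⟩
  · intro g c hg
    apply hinj
    simp only
    rw [hρF, hg, map_smul, LinearMap.toMatrix_one]
    ext i j
    by_cases hij : i = j <;> simp [hij]

end MetaW

namespace MetaW

/-! ### The explicit representation -/

theorem explicit_rep {E G : Type*} [Field E] [Group G] {q1 q2 R : ℕ} {a b : G}
    (h : Meta q1 q2 R a b) (d : ℕ) [NeZero d] (hdq : d ∣ q2) (αs : ZMod d → E)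
    (hinj : Function.Injective αs) (hstep : ∀ i, αs (i + 1) = αs i ^ R)
    (hq1 : ∀ i, αs i ^ q1 = 1) (β : E) (hβ : β ^ q2 = 1) (z : E) (hz : ∀ i, αs i ^ d = z) :
    ∃ ρ : G →* Module.End E (ZMod d → E), Submodule.span E (Set.range ρ) = ⊤ ∧
      (ρ a) ^ d = z • 1 ∧ (ρ b) ^ d = (β ^ d) • 1 := by
  classical
  have hβ0 : β ≠ 0 := by
    rintro rfl
    rw [zero_pow h.q2pos.ne'] at hβ
    exact zero_ne_one hβ
  let A : Module.End E (ZMod d → E) :=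
    { toFun := fun f i => αs i * f i
      map_add' := by intro f g; ext i; simp [mul_add]
      map_smul' := by intro c f; ext i; simp; ring }
  let B : Module.End E (ZMod d → E) :=
    { toFun := fun f i => β * f (i + 1)
      map_add' := by intro f g; ext i; simp [mul_add]
      map_smul' := by intro c f; ext i; simp; ring }
  have hA : ∀ (u : ℕ) f i, (A ^ u) f i = αs i ^ u * f i := by
    intro u
    induction u with
    | zero => intro f i; simp
    | succ u ih =>
      intro f i
      rw [pow_succ, Module.End.mul_apply, ih]
      simp only [A, LinearMap.coe_mk, AddHom.coe_mk]
      ring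
  have hB : ∀ (v : ℕ) f i, (B ^ v) f i = β ^ v * f (i + v) := by
    intro v
    induction v with
    | zero => intro f i; simp
    | succ v ih =>
      intro f i
      rw [pow_succ, Module.End.mul_apply, ih]
      simp only [B, LinearMap.coe_mk, AddHom.coe_mk]
      push_cast
      rw [← add_assoc]
      ring
  obtain ⟨ρ, hρa, hρb⟩ := h.lift A B (by ext1; ext; simp [hA, hq1])
    (by
      refine LinearMap.ext fun f => funext fun i => ?_
      rw [hB, hβ]
      have : ((q2 : ℕ) : ZMod d) = 0 := (ZMod.natCast_eq_zero_iff _ _).2 hdq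
      simp [this])
    (by
      refine LinearMap.ext fun f => funext fun i => ?_
      rw [Module.End.mul_apply, Module.End.mul_apply, hA]
      simp only [A, B, LinearMap.coe_mk, AddHom.coe_mk, hstep]
      ring)
  refine ⟨ρ, ?_, ?_, ?_⟩
  · let fam : Fin d × Fin d → Module.End E (ZMod d → E) := fun z => A ^ z.1.1 * B ^ z.2.1
    have hli : LinearIndependent E fam := by
      rw [Fintype.linearIndependent_iff]
      intro c hc
      have key : ∀ (v : Fin d) (i : ZMod d), ∑ u : Fin d, c (u, v) * αs i ^ u.1 = 0 := by
        intro v i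
        have h1 := congrFun (LinearMap.congr_fun hc (Pi.single (i + (v.1 : ZMod d)) 1)) i
        rw [LinearMap.sum_apply, Finset.sum_apply, Fintype.sum_prod_type] at h1
        have h2 : ∀ u : Fin d, (∑ v' : Fin d, (c (u, v') • fam (u, v'))
            (Pi.single (i + (v.1 : ZMod d)) (1 : E)) i) = (c (u, v) * αs i ^ u.1) * β ^ v.1 := by
          intro u
          rw [Finset.sum_eq_single v]
          · simp only [fam, LinearMap.smul_apply, Pi.smul_apply, Module.End.mul_apply, hA, hB,
              Pi.single_eq_same, smul_eq_mul]
            ring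
          · intro v' _ hv'
            simp only [fam, LinearMap.smul_apply, Pi.smul_apply, Module.End.mul_apply, hA, hB,
              smul_eq_mul]
            rw [Pi.single_eq_of_ne]
            · simp
            · intro he
              apply hv'
              have he' := add_left_cancel he
              rw [ZMod.natCast_eq_natCast_iff'] at he'
              rw [Nat.mod_eq_of_lt v'.2, Nat.mod_eq_of_lt v.2] at he'
              exact Fin.ext he'
          · simp
        simp_rw [h2] at h1
        rw [← Finset.sum_mul] at h1
        simpa [hβ0] using h1
      rintro ⟨u, v⟩
      let P : Polynomial E := ∑ u : Fin d, Polynomial.C (c (u, v)) * Polynomial.X ^ u.1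
      have hP : P = 0 := by
        apply Polynomial.eq_zero_of_natDegree_lt_card_of_eval_eq_zero P hinj
        · intro i
          simpa [P, Polynomial.eval_finsetSum] using key v i
        · rw [ZMod.card]
          by_cases hP0 : P = 0
          · rw [hP0]; simpa using Nat.pos_of_ne_zero (NeZero.ne d)
          · rw [Polynomial.natDegree_lt_iff_degree_lt hP0]
            exact Polynomial.degree_sum_fin_lt (fun u => c (u, v))
      have h3 : P.coeff u.1 = 0 := by rw [hP]; simp
      simp only [P, Polynomial.finsetSum_coeff, Polynomial.coeff_C_mul_X_pow] at h3
      rw [Finset.sum_eq_single u] at h3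
      · simpa using h3
      · intro u' _ hu'
        rw [if_neg]
        exact fun he => hu' (Fin.ext he.symm)
      · simp
    rw [eq_top_iff, ← hli.span_eq_top_of_card_eq_finrank' (by
      rw [Module.finrank_linearMap]; simp [ZMod.card])]
    apply Submodule.span_mono
    rintro _ ⟨w, rfl⟩
    exact ⟨a ^ w.1.1 * b ^ w.2.1, by rw [map_mul, map_pow, map_pow, hρa, hρb]⟩
  · rw [hρa]
    refine LinearMap.ext fun f => funext fun i => ?_
    rw [hA, hz]
    simp
  · rw [hρb]
    refine LinearMap.ext fun f => funext fun i => ?_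
    rw [hB]
    simp

end MetaW

namespace MetaW

lemma R_pow_modEq_iff {p : ℕ} (hp : p.Prime) (hodd : Odd p) (N u : ℕ) (hN : 1 ≤ N)
    (hu : ¬ p ∣ u) (t c c' : ℕ) :
    (1 + p ^ N * u) ^ c ≡ (1 + p ^ N * u) ^ c' [MOD p ^ (N + t)] ↔ c ≡ c' [MOD p ^ t] := by
  have aux : ∀ c c' : ℕ, c ≤ c' →
      ((1 + p ^ N * u) ^ c ≡ (1 + p ^ N * u) ^ c' [MOD p ^ (N + t)] ↔ c ≡ c' [MOD p ^ t]) := by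
    intro c c' h
    obtain ⟨d, rfl⟩ := Nat.exists_eq_add_of_le h
    have hRp : (1 + p ^ N * u).Coprime p := by
      rw [Nat.coprime_comm, Nat.Prime.coprime_iff_not_dvd hp,
        Nat.dvd_add_left ((dvd_pow_self p (by omega)).mul_right u)]
      exact fun hc => hp.one_lt.ne' (Nat.dvd_one.1 hc)
    have h1 : (1 + p ^ N * u) ^ c ≡ (1 + p ^ N * u) ^ (c + d) [MOD p ^ (N + t)] ↔
        1 ≡ (1 + p ^ N * u) ^ d [MOD p ^ (N + t)] := by
      rw [pow_add (1 + p ^ N * u) c d]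
      constructor
      · intro h
        exact Nat.ModEq.cancel_left_of_coprime (c := (1 + p ^ N * u) ^ c)
          (Nat.Coprime.gcd_eq_one (Nat.Coprime.pow _ _ hRp.symm)) (by simpa using h)
      · intro h
        simpa using Nat.ModEq.mul_left ((1 + p ^ N * u) ^ c) h
    rw [h1, Nat.modEq_iff_dvd' (Nat.one_le_pow _ _ (by omega)),
      pow_sub_one_dvd_iff hp hodd N u hN hu, Nat.modEq_iff_dvd' (by omega)]
    simp
  rcases le_total c c' with h | h
  · exact aux c c' h
  · rw [Nat.ModEq.comm, aux c' c h, Nat.ModEq.comm]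

theorem rep_F {F G : Type*} [Field F] [Group G] {p : ℕ} (hp : p.Prime) (hodd : Odd p)
    {N n m t u : ℕ} (hN : 1 ≤ N) (hu : ¬ p ∣ u) {a b : G}
    (h : Meta (p ^ n) (p ^ m) (1 + p ^ N * u) a b) (htm : t ≤ m) (hNt : N + t ≤ n)
    {lam : ℕ} {ζ : F} (hζ : ζ ^ (p ^ lam) = 1) (eA eB : ℕ) (hcase : eA = 1 ∨ eB = 1)
    (hz1 : (ζ ^ eA) ^ p ^ N = 1) (hz : 1 ≤ t → (ζ ^ eA) ^ p ^ (N - 1) ≠ 1)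
    (hω : (ζ ^ eB) ^ p ^ (m - t) = 1) :
    ∃ ρF : G →* Matrix (Fin (p ^ t)) (Fin (p ^ t)) F, Submodule.span F (Set.range ρF) = ⊤ ∧
      (ρF a) ^ p ^ t = (ζ ^ eA) • 1 ∧ (ρF b) ^ p ^ t = (ζ ^ eB) • 1 := by
  classical
  have := Fact.mk hp
  let E := AlgebraicClosure F
  have hpt : 0 < p ^ t := pow_pos hp.pos _
  have : NeZero (p ^ t) := ⟨hpt.ne'⟩
  set R := 1 + p ^ N * u with hR
  set z := ζ ^ eA with hzdef
  set ω := ζ ^ eB with hωdef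
  obtain ⟨α, hα⟩ := IsAlgClosed.exists_pow_nat_eq (algebraMap F E z) hpt
  obtain ⟨β, hβ⟩ := IsAlgClosed.exists_pow_nat_eq (algebraMap F E ω) hpt
  have hαN : α ^ p ^ (N + t) = 1 := by
    rw [add_comm, pow_add, pow_mul, hα, ← map_pow, hz1, map_one]
  have hper : ∀ c c', c ≡ c' [MOD p ^ t] → α ^ (R ^ c) = α ^ (R ^ c') := fun c c' hc =>
    pow_congr_mod hαN ((R_pow_modEq_iff hp hodd N u hN hu t c c').2 hc)
  let αs : ZMod (p ^ t) → E := fun i => α ^ (R ^ i.val)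
  have hinj : Function.Injective αs := by
    rcases Nat.eq_zero_or_pos t with h0 | h0
    · subst h0
      intro i j _
      have : Subsingleton (ZMod (p ^ 0)) := by rw [pow_zero]; infer_instance
      exact Subsingleton.elim _ _
    · intro i j hij
      have hord : orderOf α = p ^ (N - 1 + t + 1) := by
        apply orderOf_eq_prime_pow
        · rw [add_comm, pow_add, pow_mul, hα, ← map_pow, ← (algebraMap F E).map_one]
          exact fun hc => hz h0 ((algebraMap F E).injective hc)
        · rw [← hαN]; congr 2; omega
      have h1 : R ^ i.val ≡ R ^ j.val [MOD p ^ (N + t)] := by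
        obtain ⟨α', hα'⟩ : IsUnit α := IsUnit.of_pow_eq_one hαN (pow_pos hp.pos _).ne'
        have h2 : α' ^ (R ^ i.val) = α' ^ (R ^ j.val) := by
          ext
          push_cast
          rw [hα']
          exact hij
        rw [pow_eq_pow_iff_modEq, ← orderOf_units, hα', hord] at h2
        rwa [show N - 1 + t + 1 = N + t by omega] at h2
      rw [R_pow_modEq_iff hp hodd N u hN hu] at h1
      have h2 := (ZMod.natCast_eq_natCast_iff _ _ _).2 h1
      simpa using h2
  have hzR : ∀ c, z ^ (R ^ c) = z := by
    intro c
    have : R ^ c ≡ 1 [MOD p ^ N] := by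
      have : R ≡ 1 [MOD p ^ N] := by
        rw [hR]; simp [Nat.ModEq]
      simpa using this.pow c
    simpa using pow_congr_mod hz1 this
  obtain ⟨ρ, hspan, hρa, hρb⟩ := explicit_rep h (p ^ t) (pow_dvd_pow p htm) αs hinj
    (by
      intro i
      simp only [αs]
      rw [← pow_mul, ← pow_succ]
      apply hper
      rw [← ZMod.natCast_eq_natCast_iff]
      simp)
    (by
      intro i
      simp only [αs]
      obtain ⟨c, rfl⟩ := Nat.exists_eq_add_of_le hNt
      rw [← pow_mul, mul_comm, pow_mul, pow_add, pow_mul α, hαN, one_pow, one_pow])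
    β
    (by
      obtain ⟨c, rfl⟩ := Nat.exists_eq_add_of_le htm
      rw [pow_add, pow_mul, hβ, ← map_pow]
      simp only [Nat.add_sub_cancel_left] at hω
      rw [hω, map_one])
    (algebraMap F E z)
    (by
      intro i
      simp only [αs]
      rw [← pow_mul, mul_comm, pow_mul, hα, ← map_pow, hzR])
  rw [hβ] at hρb
  have hR1 : 1 ≤ R := by omega
  have hpR : p ∣ R - 1 := by
    rw [hR, Nat.add_sub_cancel_left]
    exact (dvd_pow_self p (by omega)).mul_right u
  have hc : ∀ i, ∃ c : ℕ, c.Coprime p ∧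
      ∑ j ∈ Finset.range (p ^ t), (R ^ i) ^ j = p ^ t * c := by
    intro i
    have hQ1 : 1 ≤ R ^ i := Nat.one_le_pow _ _ hR1
    have hQ : p ∣ R ^ i - 1 := hpR.trans (by simpa using Nat.sub_dvd_pow_sub_pow R 1 i)
    obtain ⟨c, hc⟩ := (geom_dvd_iff hp hodd (R ^ i) hQ1 hQ t (p ^ t)).2 dvd_rfl
    refine ⟨c, ?_, hc⟩
    rw [Nat.coprime_comm, Nat.Prime.coprime_iff_not_dvd hp]
    rintro ⟨e, rfl⟩
    have h2 : p ^ (t + 1) ∣ p ^ t := by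
      rw [← geom_dvd_iff hp hodd (R ^ i) hQ1 hQ, hc]
      exact Dvd.intro e (by ring)
    rw [Nat.pow_dvd_pow_iff_le_right hp.one_lt] at h2
    omega
  have hinvc : ∀ c : ℕ, c.Coprime p → ∃ l : ℕ, l.Coprime p ∧ l * c ≡ 1 [MOD p ^ lam] := by
    intro c hc
    obtain ⟨l, _, hl⟩ := Nat.exists_mul_mod_eq_one_of_coprime (hc.pow_right (lam + 1))
      (Nat.one_lt_pow (by omega) hp.one_lt)
    have hl' : c * l ≡ 1 [MOD p ^ (lam + 1)] := by
      rw [Nat.ModEq, hl, Nat.mod_eq_of_lt (Nat.one_lt_pow (by omega) hp.one_lt)]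
    refine ⟨l, ?_, ?_⟩
    · rw [Nat.coprime_comm, Nat.Prime.coprime_iff_not_dvd hp]
      rintro ⟨e, rfl⟩
      have h3 : c * (p * e) ≡ 1 [MOD p] := hl'.of_dvd (dvd_pow_self p (by omega))
      have h4 : c * (p * e) ≡ 0 [MOD p] := (Nat.modEq_zero_iff_dvd).2 ⟨c * e, by ring⟩
      have h5 := h4.symm.trans h3
      have := (Nat.modEq_zero_iff_dvd).1 h5.symm
      exact hp.one_lt.ne' (Nat.dvd_one.1 this)
    · rw [mul_comm]
      exact hl'.of_dvd (pow_dvd_pow p (by omega))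
  have hxd : ∀ l i c : ℕ, ∑ j ∈ Finset.range (p ^ t), (R ^ i) ^ j = p ^ t * c →
      (ρ (a ^ l * b ^ i)) ^ p ^ t = algebraMap F E (ζ ^ (eA * (l * c) + eB * i)) • 1 := by
    intro l i c hc
    rw [← map_pow, mul_pow_of_rel h.hba, hc, map_mul, map_pow, map_pow,
      show l * (p ^ t * c) = p ^ t * (l * c) by ring, mul_comm i, pow_mul (ρ a), pow_mul (ρ b), hρa, hρb,
      smul_pow, smul_pow, one_pow, one_pow, smul_mul_smul_comm, mul_one, ← map_pow, ← map_pow,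
      ← map_mul, pow_add, pow_mul ζ eA, pow_mul ζ eB]
  have hfin : Module.finrank E (ZMod (p ^ t) → E) = p ^ t := by simp [ZMod.card]
  have hlast : ∃ ρF : G →* Matrix (Fin (p ^ t)) (Fin (p ^ t)) F,
      Submodule.span F (Set.range ρF) = ⊤ ∧
      ∀ (g : G) (c : F), ρ g = algebraMap F E c • 1 → ρF g = c • 1 := by
    rcases hcase with h1 | h1
    · obtain ⟨c, hcp, hc⟩ := hc 1
      obtain ⟨l, -, hl⟩ := hinvc c hcp
      have hl2 : ζ ^ (l * c) = ζ := by simpa using pow_congr_mod hζ hl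
      refine descent (p ^ t) hpt hfin ρ hspan (a ^ (l * (eB * (p ^ lam - 1))) * b) a
        (h.factA _) ?_ z hρa
      have := hxd (l * (eB * (p ^ lam - 1))) 1 c hc
      rw [pow_one] at this
      rw [this, h1, show 1 * (l * (eB * (p ^ lam - 1)) * c) + eB * 1
        = l * c * (eB * (p ^ lam - 1)) + eB by ring, pow_add, pow_mul, hl2, ← pow_add,
        ← Nat.mul_succ, Nat.succ_eq_add_one, Nat.sub_add_cancel (Nat.one_le_pow _ _ hp.pos),
        mul_comm, pow_mul, hζ]
      simp
    · obtain ⟨c, hcp, hc⟩ := hc (eA * (p ^ lam - 1))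
      obtain ⟨l, hlp, hl⟩ := hinvc c hcp
      have hl2 : ζ ^ (l * c) = ζ := by simpa using pow_congr_mod hζ hl
      refine descent (p ^ t) hpt hfin ρ hspan (a ^ l * b ^ (eA * (p ^ lam - 1))) b
        (factB hp hodd h hpR hR1 l _ hlp) ?_ ω hρb
      rw [hxd l _ c hc, h1, mul_comm eA, pow_add, pow_mul, hl2, one_mul, ← pow_add, add_comm,
        ← Nat.mul_succ, Nat.succ_eq_add_one, Nat.sub_add_cancel (Nat.one_le_pow _ _ hp.pos),
        mul_comm, pow_mul, hζ]
      simp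
  obtain ⟨ρF, hsp, hsc⟩ := hlast
  refine ⟨ρF, hsp, ?_, ?_⟩
  · rw [← map_pow]; exact hsc _ _ (by rw [map_pow, hρa])
  · rw [← map_pow]; exact hsc _ _ (by rw [map_pow, hρb])

end MetaW

namespace MetaW

/-- Numerical data of a simple component. -/
structure Dat where
  t : ℕ
  lam : ℕ
  eA : ℕ
  eB : ℕ

/-- Admissibility of the numerical data. -/
structure Dat.Valid (p N n m : ℕ) (D : Dat) : Prop where
  htm : D.t ≤ m
  hNt : N + D.t ≤ n
  hc : (D.eA = 1 ∧ D.eB < p ^ D.lam) ∨ (D.eB = 1 ∧ p ∣ D.eA ∧ D.eA < p ^ D.lam ∧ 1 ≤ D.lam)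
  h1 : p ^ D.lam ∣ D.eA * p ^ N
  h2 : 1 ≤ D.t → ¬ p ^ D.lam ∣ D.eA * p ^ (N - 1)
  h3 : p ^ D.lam ∣ D.eB * p ^ (m - D.t)

lemma lam_le {p lam lam' eA eB eA' eB' : ℕ} (hp : p.Prime)
    (hc : eA = 1 ∨ eB = 1)
    (H : ∀ i j, p ^ lam ∣ eA * i + eB * j ↔ p ^ lam' ∣ eA' * i + eB' * j) : lam ≤ lam' := by
  rcases hc with h | h
  · have := (H (p ^ lam') 0).2 (by simp)
    rw [h] at this
    simpa [Nat.pow_dvd_pow_iff_le_right hp.one_lt] using this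
  · have := (H 0 (p ^ lam')).2 (by simp)
    rw [h] at this
    simpa [Nat.pow_dvd_pow_iff_le_right hp.one_lt] using this

lemma e_eq {q e e' : ℕ} (he : e < q) (he' : e' < q) (h : q ∣ e + e' * (q - 1)) : e = e' := by
  have h0 : 1 ≤ q := by omega
  have h1 : e + e' * (q - 1) + e' = e + q * e' := by
    obtain ⟨q, rfl⟩ := Nat.exists_eq_add_of_le h0
    simp; ring
  have h2 : e + e' * (q - 1) + e' ≡ 0 + e' [MOD q] :=
    Nat.ModEq.add_right e' ((Nat.modEq_zero_iff_dvd).2 h)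
  rw [h1, zero_add] at h2
  have h3 : e ≡ e' [MOD q] := by
    simpa [Nat.ModEq] using h2
  exact Nat.ModEq.eq_of_lt_of_lt h3 he he'

lemma Dat.Valid.ext_of_dvd {p N n m : ℕ} (hp : p.Prime) {D D' : Dat} (hD : D.Valid p N n m)
    (hD' : D'.Valid p N n m) (ht : D.t = D'.t)
    (H : ∀ i j, p ^ D.lam ∣ D.eA * i + D.eB * j ↔ p ^ D'.lam ∣ D'.eA * i + D'.eB * j) :
    D = D' := by
  obtain ⟨t, lam, eA, eB⟩ := D
  obtain ⟨t', lam', eA', eB'⟩ := D'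
  have h1 := hD.hc
  have h1' := hD'.hc
  simp only at *
  subst ht
  have hlam : lam = lam' := by
    apply le_antisymm
    · exact lam_le hp (by omega) H
    · exact lam_le hp (by omega) (fun i j => (H i j).symm)
  subst hlam
  have key : ∀ x y : ℕ, 1 ≤ lam → p ∣ y → ¬ p ^ lam ∣ 1 + x * y := by
    intro x y hl hy hd
    have h2 : p ∣ 1 + x * y := (dvd_pow_self p (by omega)).trans hd
    rw [Nat.dvd_add_left (hy.mul_left x)] at h2
    exact hp.one_lt.ne' (Nat.dvd_one.1 h2)
  rcases h1 with ⟨rfl, hB⟩ | ⟨rfl, hdA, hA, hl⟩ <;> rcases h1' with ⟨rfl, hB'⟩ | ⟨rfl, hdA', hA', hl'⟩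
  · have h0 : 1 ≤ p ^ lam := by omega
    have := (H (eB' * (p ^ lam - 1)) 1).2 (by
      obtain ⟨q, hq⟩ := Nat.exists_eq_add_of_le h0
      rw [hq]
      exact Dvd.intro eB' (by simp; ring))
    have h2 := e_eq hB hB' (by simpa [add_comm] using this)
    rw [h2]
  · exfalso
    have h0 : 1 ≤ p ^ lam := by omega
    have := (H 1 (eA' * (p ^ lam - 1))).2 (by
      obtain ⟨q, hq⟩ := Nat.exists_eq_add_of_le h0
      rw [hq]
      exact Dvd.intro eA' (by simp; ring))
    rw [mul_one] at this
    exact key _ _ hl' (hdA'.mul_right _) this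
  · exfalso
    have h0 : 1 ≤ p ^ lam := by omega
    have := (H 1 (eA * (p ^ lam - 1))).1 (by
      obtain ⟨q, hq⟩ := Nat.exists_eq_add_of_le h0
      rw [hq]
      exact Dvd.intro eA (by simp; ring))
    rw [mul_one] at this
    exact key _ _ hl (hdA.mul_right _) this
  · have h0 : 1 ≤ p ^ lam := by omega
    have := (H 1 (eA' * (p ^ lam - 1))).2 (by
      obtain ⟨q, hq⟩ := Nat.exists_eq_add_of_le h0
      rw [hq]
      exact Dvd.intro eA' (by simp; ring))
    have h2 := e_eq hA hA' (by simpa [add_comm] using this)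
    rw [h2]

/-- The target of the component with data `(t, lam)`. -/
abbrev Comp (p t lam : ℕ) : Type :=
  Matrix (Fin (p ^ t)) (Fin (p ^ t)) (CyclotomicField (p ^ lam) ℚ)

lemma surj_of_span {K F G : Type*} [Field K] [Field F] [Algebra K F] [Group G] {d : ℕ}
    (ρ : G →* Matrix (Fin d) (Fin d) F) (hs : Submodule.span F (Set.range ρ) = ⊤)
    (ζ : F) (hζ : Algebra.adjoin K {ζ} = ⊤) (g : G) (hg : ρ g = ζ • 1) :
    Function.Surjective (MonoidAlgebra.lift K (Matrix (Fin d) (Fin d) F) G ρ) := by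
  set φ := MonoidAlgebra.lift K (Matrix (Fin d) (Fin d) F) G ρ with hφ
  have hφg : ∀ x, φ (MonoidAlgebra.of K G x) = ρ x := fun x => by simp [hφ]
  have hsc : ∀ c : F, c • (1 : Matrix (Fin d) (Fin d) F) ∈ φ.range := by
    intro c
    have hc : c ∈ Algebra.adjoin K {ζ} := by rw [hζ]; trivial
    induction hc using Algebra.adjoin_induction with
    | mem x hx =>
      rw [Set.mem_singleton_iff] at hx
      exact ⟨MonoidAlgebra.of K G g, by rw [hx, ← hg]; exact hφg g⟩
    | algebraMap r =>
      have : (algebraMap K F r) • (1 : Matrix (Fin d) (Fin d) F) = algebraMap K _ r := by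
        rw [algebraMap_smul, Algebra.algebraMap_eq_smul_one]
      rw [this]
      exact φ.range.algebraMap_mem r
    | add x y _ _ hx hy => rw [add_smul]; exact add_mem hx hy
    | mul x y _ _ hx hy =>
      have : (x * y) • (1 : Matrix (Fin d) (Fin d) F) = (x • 1) * (y • 1) := by
        rw [smul_mul_smul_comm, mul_one]
      rw [this]; exact mul_mem hx hy
  intro y
  have hy : y ∈ Submodule.span F (Set.range ρ) := by rw [hs]; trivial
  change y ∈ φ.range
  induction hy using Submodule.span_induction with
  | mem x hx => obtain ⟨x, rfl⟩ := hx; exact ⟨_, hφg x⟩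
  | zero => exact zero_mem _
  | add x y _ _ hx hy => exact add_mem hx hy
  | smul c x _ hx =>
    have : c • x = (c • 1) * x := by rw [smul_mul_assoc, one_mul]
    rw [this]; exact mul_mem (hsc c) hx

theorem comp_exists {G : Type*} [Group G] {p : ℕ} (hp : p.Prime) (hodd : Odd p)
    {N n m u : ℕ} (hN : 1 ≤ N) (hu : ¬ p ∣ u) {a b : G}
    (h : Meta (p ^ n) (p ^ m) (1 + p ^ N * u) a b) (D : Dat) (hD : D.Valid p N n m) :
    ∃ φ : MonoidAlgebra ℚ G →ₐ[ℚ] Comp p D.t D.lam, Function.Surjective φ ∧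
      ∀ i j, φ (MonoidAlgebra.of ℚ G ((a ^ p ^ D.t) ^ i * (b ^ p ^ D.t) ^ j)) = 1 ↔
        p ^ D.lam ∣ D.eA * i + D.eB * j := by
  have : NeZero (p ^ D.lam) := ⟨(pow_pos hp.pos _).ne'⟩
  have : NeZero (p ^ D.t) := ⟨(pow_pos hp.pos _).ne'⟩
  let F := CyclotomicField (p ^ D.lam) ℚ
  have : NeZero ((p ^ D.lam : ℕ) : ℚ) := ⟨by exact_mod_cast (pow_pos hp.pos _).ne'⟩
  have : IsCyclotomicExtension {p ^ D.lam} ℚ F := CyclotomicField.isCyclotomicExtension _ _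
  let ζ : F := IsCyclotomicExtension.zeta (p ^ D.lam) ℚ F
  have hprim : IsPrimitiveRoot ζ (p ^ D.lam) := IsCyclotomicExtension.zeta_spec _ _ _
  obtain ⟨ρ, hs, hρa, hρb⟩ := rep_F (F := F) hp hodd hN hu h hD.htm hD.hNt (lam := D.lam) (ζ := ζ)
    hprim.pow_eq_one D.eA D.eB (by have := hD.hc; omega)
    (by rw [← pow_mul, hprim.pow_eq_one_iff_dvd]; exact hD.h1)
    (by intro ht; rw [← pow_mul, Ne, hprim.pow_eq_one_iff_dvd]; exact hD.h2 ht)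
    (by rw [← pow_mul, hprim.pow_eq_one_iff_dvd]; exact hD.h3)
  refine ⟨MonoidAlgebra.lift ℚ _ G ρ, ?_, ?_⟩
  · have had : Algebra.adjoin ℚ {ζ} = ⊤ := IsCyclotomicExtension.adjoin_primitive_root_eq_top hprim
    rcases hD.hc with h1 | h1
    · exact surj_of_span ρ hs ζ had (a ^ p ^ D.t) (by rw [map_pow, hρa, h1.1, pow_one])
    · exact surj_of_span ρ hs ζ had (b ^ p ^ D.t) (by rw [map_pow, hρb, h1.1, pow_one])
  · intro i j
    have h1 : MonoidAlgebra.lift ℚ (Comp p D.t D.lam) G ρ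
        (MonoidAlgebra.of ℚ G ((a ^ p ^ D.t) ^ i * (b ^ p ^ D.t) ^ j))
        = ζ ^ (D.eA * i + D.eB * j) • 1 := by
      rw [MonoidAlgebra.lift_of, map_mul, map_pow, map_pow, map_pow, map_pow, hρa, hρb, smul_pow,
        smul_pow, one_pow, one_pow, smul_mul_smul_comm, mul_one, ← pow_mul, ← pow_mul, ← pow_add]
    rw [h1, ← hprim.pow_eq_one_iff_dvd]
    constructor
    · intro h2
      have := congrFun (congrFun h2 0) 0
      simpa using this
    · intro h2
      rw [h2, one_smul]

theorem dat_eq {G : Type*} [Group G] {p : ℕ} (hp : p.Prime)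
    {N n m : ℕ} (hN : 1 ≤ N) {a b : G} (D D' : Dat) (hD : D.Valid p N n m) (hD' : D'.Valid p N n m)
    (φ : MonoidAlgebra ℚ G →ₐ[ℚ] Comp p D.t D.lam) (φ' : MonoidAlgebra ℚ G →ₐ[ℚ] Comp p D'.t D'.lam)
    (hφ : ∀ i j, φ (MonoidAlgebra.of ℚ G ((a ^ p ^ D.t) ^ i * (b ^ p ^ D.t) ^ j)) = 1 ↔
        p ^ D.lam ∣ D.eA * i + D.eB * j)
    (hφ' : ∀ i j, φ' (MonoidAlgebra.of ℚ G ((a ^ p ^ D'.t) ^ i * (b ^ p ^ D'.t) ^ j)) = 1 ↔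
        p ^ D'.lam ∣ D'.eA * i + D'.eB * j)
    (hk : ∀ x, φ x = 0 ↔ φ' x = 0) : D = D' := by
  have hg : ∀ g, φ (MonoidAlgebra.of ℚ G g) = 1 ↔ φ' (MonoidAlgebra.of ℚ G g) = 1 := by
    intro g
    have := hk (MonoidAlgebra.of ℚ G g - 1)
    rwa [map_sub, map_sub, map_one, map_one, sub_eq_zero, sub_eq_zero] at this
  have hle : ∀ (D D' : Dat) (_ : D.Valid p N n m) (_ : D'.Valid p N n m)
    (φ : MonoidAlgebra ℚ G →ₐ[ℚ] Comp p D.t D.lam) (φ' : MonoidAlgebra ℚ G →ₐ[ℚ] Comp p D'.t D'.lam)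
    (_ : ∀ i j, φ (MonoidAlgebra.of ℚ G ((a ^ p ^ D.t) ^ i * (b ^ p ^ D.t) ^ j)) = 1 ↔
        p ^ D.lam ∣ D.eA * i + D.eB * j)
    (_ : ∀ i j, φ' (MonoidAlgebra.of ℚ G ((a ^ p ^ D'.t) ^ i * (b ^ p ^ D'.t) ^ j)) = 1 ↔
        p ^ D'.lam ∣ D'.eA * i + D'.eB * j)
    (_ : ∀ g, φ (MonoidAlgebra.of ℚ G g) = 1 ↔ φ' (MonoidAlgebra.of ℚ G g) = 1), D'.t ≤ D.t := by
    intro D D' hD hD' φ φ' hφ hφ' hg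
    by_contra! hlt
    have h1 := (hφ (p ^ N) 0).2 (by simpa using hD.h1)
    rw [hg] at h1
    have h2 : φ' (MonoidAlgebra.of ℚ G ((a ^ p ^ D'.t) ^ (p ^ (N - 1)) * (b ^ p ^ D'.t) ^ 0)) = 1 := by
      obtain ⟨c, hc⟩ := Nat.exists_eq_add_of_lt hlt
      have : (a ^ p ^ D'.t) ^ (p ^ (N - 1)) = ((a ^ p ^ D.t) ^ p ^ N) ^ p ^ c := by
        rw [← pow_mul, ← pow_mul, ← pow_mul, ← pow_add, ← pow_add, ← pow_add]
        congr 2; omega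
      rw [pow_zero, mul_one] at h1 ⊢
      rw [this, map_pow, map_pow, h1, one_pow]
    rw [hφ'] at h2
    exact hD'.h2 (by omega) (by simpa using h2)
  have ht : D.t = D'.t := le_antisymm
    (hle D' D hD' hD φ' φ hφ' hφ (fun g => (hg g).symm)) (hle D D' hD hD' φ φ' hφ hφ' hg)
  refine hD.ext_of_dvd hp hD' ht ?_
  intro i j
  rw [← hφ, ← hφ', hg, ht]

end MetaW

namespace MetaW

/-- The `i`-th natural number prime to `p`. -/
def U (p i : ℕ) : ℕ := p * (i / (p - 1)) + (i % (p - 1) + 1)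

lemma U_not_dvd {p : ℕ} (hp : p.Prime) (i : ℕ) : ¬ p ∣ U p i := by
  have h2 := hp.two_le
  have h3 := Nat.mod_lt i (show 0 < p - 1 by omega)
  rw [U, Nat.dvd_add_right (Dvd.intro _ rfl)]
  intro h
  have := Nat.le_of_dvd (by omega) h
  omega

lemma U_inj {p : ℕ} (hp : p.Prime) {i j : ℕ} (h : U p i = U p j) : i = j := by
  have h2 := hp.two_le
  have h3 := Nat.mod_lt i (show 0 < p - 1 by omega)
  have h4 := Nat.mod_lt j (show 0 < p - 1 by omega)
  unfold U at h
  have h5 : i / (p - 1) = j / (p - 1) := by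
    have := congrArg (fun x => x / p) h
    beta_reduce at this
    rwa [Nat.mul_add_div hp.pos, Nat.mul_add_div hp.pos, Nat.div_eq_of_lt (show i % (p - 1) + 1 < p by omega),
      Nat.div_eq_of_lt (show j % (p - 1) + 1 < p by omega), add_zero, add_zero] at this
  rw [h5] at h
  have h6 : i % (p - 1) = j % (p - 1) := by omega
  rw [← Nat.div_add_mod i (p - 1), ← Nat.div_add_mod j (p - 1), h5, h6]

lemma U_lt {p N : ℕ} (hp : p.Prime) (hN : 1 ≤ N) {i : ℕ} (h : i < p ^ N - p ^ (N - 1)) :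
    U p i < p ^ N := by
  have h2 := hp.two_le
  obtain ⟨M, rfl⟩ := Nat.exists_eq_add_of_le' hN
  have h3 := Nat.mod_lt i (show 0 < p - 1 by omega)
  have h4 : i / (p - 1) < p ^ M := by
    rw [Nat.div_lt_iff_lt_mul (by omega), Nat.mul_sub, mul_one, ← pow_succ]
    exact h
  unfold U
  calc p * (i / (p - 1)) + (i % (p - 1) + 1) < p * (i / (p - 1)) + p := by omega
    _ = p * (i / (p - 1) + 1) := by ring
    _ ≤ p * p ^ M := Nat.mul_le_mul_left _ h4
    _ = p ^ (M + 1) := by ring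

/-- Index types of the components. -/
abbrev I2 (p N : ℕ) : Type := Σ l : Fin N, Fin (p ^ (l.1 + 1) + p ^ l.1)
abbrev I3 (p N m : ℕ) : Type := Σ _ : Fin (m - N), Fin (p ^ N)
abbrev I4 (p N k : ℕ) : Type := Σ _ : Fin (k - 1), Fin (p ^ N)
abbrev I5 (p N m k : ℕ) : Type :=
  Σ j : Fin (k - 1), Σ _ : Fin (m - (j.1 + 1) - N), Fin (p ^ N - p ^ (N - 1))
abbrev I6 (p m s k : ℕ) : Type := Σ j : Fin (s - k + 1), Fin (p ^ (m - (k + j.1)))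
abbrev Idx (p N m s k : ℕ) : Type :=
  Unit ⊕ (I2 p N ⊕ (I3 p N m ⊕ (I4 p N k ⊕ (I5 p N m k ⊕ I6 p m s k))))

def d2 (p N : ℕ) (x : I2 p N) : Dat :=
  ⟨0, x.1.1 + 1, if x.2.1 < p ^ (x.1.1 + 1) then 1 else p * (x.2.1 - p ^ (x.1.1 + 1)),
    if x.2.1 < p ^ (x.1.1 + 1) then x.2.1 else 1⟩
def d3 (p N m : ℕ) (x : I3 p N m) : Dat := ⟨0, N + 1 + x.1.1, p ^ (x.1.1 + 1) * x.2.1, 1⟩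
def d4 (p N k : ℕ) (x : I4 p N k) : Dat := ⟨x.1.1 + 1, N, 1, x.2.1⟩
def d5 (p N m k : ℕ) (x : I5 p N m k) : Dat :=
  ⟨x.1.1 + 1, N + 1 + x.2.1.1, p ^ (x.2.1.1 + 1) * U p x.2.2.1, 1⟩
def d6 (p N m s k : ℕ) (x : I6 p m s k) : Dat := ⟨k + x.1.1, N, 1, p ^ x.1.1 * x.2.1⟩

def dat (p N m s k : ℕ) : Idx p N m s k → Dat :=
  Sum.elim (fun _ => ⟨0, 0, 1, 0⟩) (Sum.elim (d2 p N) (Sum.elim (d3 p N m)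
    (Sum.elim (d4 p N k) (Sum.elim (d5 p N m k) (d6 p N m s k)))))

lemma dat_valid {p N n m s k : ℕ} (hp : p.Prime) (hN : 1 ≤ N) (hn : n = N + s) (hm : m = N + k)
    (hk : 1 ≤ k) (hks : k ≤ s) (hsm : s ≤ m) (x : Idx p N m s k) :
    (dat p N m s k x).Valid p N n m := by
  have h2 := hp.two_le
  have hpow : ∀ a, 1 ≤ p ^ a := fun a => Nat.one_le_pow _ _ hp.pos
  rcases x with x | ⟨l, i⟩ | ⟨l, i⟩ | ⟨j, i⟩ | ⟨j, l, i⟩ | ⟨j, i⟩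
  · exact ⟨by simp [dat], by simp [dat]; omega, by simp [dat], by simp [dat], by simp [dat], by simp [dat]⟩
  · have hl := l.2
    have hi := i.2
    have hpp : p ^ (l.1 + 1) = p * p ^ l.1 := by ring
    by_cases hc : i.1 < p ^ (l.1 + 1)
    · simp only [dat, d2, Sum.elim_inr, Sum.elim_inl, hc, if_true]
      refine ⟨by simp, by simp; omega, Or.inl ⟨rfl, hc⟩, ?_, by simp, ?_⟩
      · simpa using pow_dvd_pow p (by omega)
      · exact (pow_dvd_pow p (by simp; omega)).mul_left _
    · simp only [dat, d2, Sum.elim_inr, Sum.elim_inl, hc, if_false]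
      refine ⟨by simp, by simp; omega, Or.inr ⟨rfl, Dvd.intro _ rfl, ?_, by simp⟩, ?_, by simp, ?_⟩
      · have h7 : i.1 - p ^ (l.1 + 1) < p ^ l.1 := by omega
        exact (Nat.mul_lt_mul_of_pos_left h7 hp.pos).trans_eq hpp.symm
      · exact (pow_dvd_pow p (by simp)).mul_left _
      · exact (pow_dvd_pow p (by simp; omega)).mul_left _
  · have hl := l.2
    have hi := i.2
    simp only [dat, d3, Sum.elim_inr, Sum.elim_inl]
    refine ⟨by simp, by simp; omega, Or.inr ⟨rfl, (dvd_pow_self p (by simp)).mul_right _, ?_, by simp; omega⟩, ?_, by simp, ?_⟩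
    · simp only
      rw [show N + 1 + l.1 = (l.1 + 1) + N by ring, pow_add p (l.1 + 1)]
      exact Nat.mul_lt_mul_of_pos_left hi (hpow _)
    · exact ⟨i.1, by simp; ring⟩
    · exact (pow_dvd_pow p (by simp; omega)).mul_left _
  · have hl := j.2
    have hi := i.2
    simp only [dat, d4, Sum.elim_inr, Sum.elim_inl]
    refine ⟨by simp; omega, by simp; omega, Or.inl ⟨rfl, hi⟩, by simp, ?_, ?_⟩
    · simp [Nat.pow_dvd_pow_iff_le_right hp.one_lt]; omega
    · exact (pow_dvd_pow p (by simp; omega)).mul_left _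
  · have hj := j.2
    have hl := l.2
    have hi := i.2
    simp only [dat, d5, Sum.elim_inr, Sum.elim_inl]
    refine ⟨by simp; omega, by simp; omega, Or.inr ⟨rfl, (dvd_pow_self p (by simp)).mul_right _, ?_, by simp; omega⟩, ?_, ?_, ?_⟩
    · simp only
      rw [show N + 1 + l.1 = (l.1 + 1) + N by ring, pow_add p (l.1 + 1)]
      exact Nat.mul_lt_mul_of_pos_left (U_lt hp hN hi) (hpow _)
    · exact ⟨U p i.1, by simp; ring⟩
    · intro _ hd
      simp only at hd
      obtain ⟨M, rfl⟩ := Nat.exists_eq_add_of_le' hN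
      simp only [Nat.add_sub_cancel] at hd
      rw [show p ^ (l.1 + 1) * U p i.1 * p ^ M = p ^ (M + 1 + l.1) * U p i.1 by ring,
        show M + 1 + 1 + l.1 = M + 1 + l.1 + 1 by ring, pow_succ p (M + 1 + l.1)] at hd
      exact U_not_dvd hp _ (Nat.dvd_of_mul_dvd_mul_left (hpow _) hd)
    · exact (pow_dvd_pow p (by simp; omega)).mul_left _
  · have hj := j.2
    have hi := i.2
    have hjN : j.1 ≤ N := by omega
    have h6 : p ^ N = p ^ j.1 * p ^ (m - (k + j.1)) := by
      rw [← pow_add]; congr 1; omega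
    simp only [dat, d6, Sum.elim_inr]
    refine ⟨by simp; omega, by simp; omega, Or.inl ⟨rfl, ?_⟩, by simp, ?_, ?_⟩
    · simp only
      rw [h6]
      exact Nat.mul_lt_mul_of_pos_left hi (hpow _)
    · simp [Nat.pow_dvd_pow_iff_le_right hp.one_lt]; omega
    · simp only
      exact ⟨i.1, by rw [h6]; ring⟩

lemma dat_inj {p N m s k : ℕ} (hp : p.Prime) (hN : 1 ≤ N) (hk : 1 ≤ k) :
    Function.Injective (dat p N m s k) := by
  have hpow : ∀ a, 0 < p ^ a := fun a => pow_pos hp.pos _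
  have hd2 : Function.Injective (d2 p N) := by
    rintro ⟨l, i⟩ ⟨l', i'⟩ h
    simp only [d2, Dat.mk.injEq] at h
    obtain rfl : l = l' := Fin.ext (by omega)
    obtain ⟨-, -, h3, h4⟩ := h
    have : i.1 = i'.1 := by
      have hA : ∀ x, 1 ≠ p * x := fun x hx => hp.one_lt.ne' (Nat.dvd_one.1 ⟨x, hx⟩)
      split_ifs at h3 h4 with h5 h6
      · exact h4
      · exact absurd h3 (hA _)
      · exact absurd h3.symm (hA _)
      · have := Nat.eq_of_mul_eq_mul_left hp.pos h3
        omega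
    rw [Fin.ext this]
  have hd3 : Function.Injective (d3 p N m) := by
    rintro ⟨l, i⟩ ⟨l', i'⟩ h
    simp only [d3, Dat.mk.injEq] at h
    obtain rfl : l = l' := Fin.ext (by omega)
    rw [Fin.ext (Nat.eq_of_mul_eq_mul_left (hpow _) h.2.2.1)]
  have hd4 : Function.Injective (d4 p N k) := by
    rintro ⟨l, i⟩ ⟨l', i'⟩ h
    simp only [d4, Dat.mk.injEq] at h
    obtain rfl : l = l' := Fin.ext (by omega)
    rw [Fin.ext h.2.2.2]
  have hd5 : Function.Injective (d5 p N m k) := by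
    rintro ⟨j, l, i⟩ ⟨j', l', i'⟩ h
    simp only [d5, Dat.mk.injEq] at h
    obtain rfl : j = j' := Fin.ext (by omega)
    obtain rfl : l = l' := Fin.ext (by omega)
    rw [Fin.ext (U_inj hp (Nat.eq_of_mul_eq_mul_left (hpow _) h.2.2.1))]
  have hd6 : Function.Injective (d6 p N m s k) := by
    rintro ⟨l, i⟩ ⟨l', i'⟩ h
    simp only [d6, Dat.mk.injEq] at h
    obtain rfl : l = l' := Fin.ext (by omega)
    rw [Fin.ext (Nat.eq_of_mul_eq_mul_left (hpow _) h.2.2.2)]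
  unfold dat
  refine Function.Injective.sumElim (fun _ _ _ => rfl) (Function.Injective.sumElim hd2
    (Function.Injective.sumElim hd3 (Function.Injective.sumElim hd4
    (Function.Injective.sumElim hd5 hd6 ?_) ?_) ?_) ?_) ?_
  · intro x y h
    simp only [d5, d6, Dat.mk.injEq] at h
    omega
  · rintro x (y | y) h
    · simp only [Sum.elim_inl, d4, d5, Dat.mk.injEq] at h
      omega
    · simp only [Sum.elim_inr, d4, d6, Dat.mk.injEq] at h
      have := x.1.2
      omega
  · rintro x (y | y | y) h
    · simp only [Sum.elim_inl, d3, d4, Dat.mk.injEq] at h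
      omega
    · simp only [Sum.elim_inl, Sum.elim_inr, d3, d5, Dat.mk.injEq] at h
      omega
    · simp only [Sum.elim_inr, d3, d6, Dat.mk.injEq] at h
      omega
  · rintro x (y | y | y | y) h
    · simp only [Sum.elim_inl, d2, d3, Dat.mk.injEq] at h
      have := x.1.2
      omega
    · simp only [Sum.elim_inl, Sum.elim_inr, d2, d4, Dat.mk.injEq] at h
      omega
    · simp only [Sum.elim_inl, Sum.elim_inr, d2, d5, Dat.mk.injEq] at h
      omega
    · simp only [Sum.elim_inr, d2, d6, Dat.mk.injEq] at h
      have := x.1.2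
      omega
  · rintro x (y | y | y | y | y) h
    · simp only [Sum.elim_inl, d2, Dat.mk.injEq] at h
      omega
    · simp only [Sum.elim_inl, Sum.elim_inr, d3, Dat.mk.injEq] at h
      omega
    · simp only [Sum.elim_inl, Sum.elim_inr, d4, Dat.mk.injEq] at h
      omega
    · simp only [Sum.elim_inl, Sum.elim_inr, d5, Dat.mk.injEq] at h
      omega
    · simp only [Sum.elim_inr, d6, Dat.mk.injEq] at h
      omega

lemma sum1 (q N : ℕ) :
    1 + ∑ l ∈ Finset.range N, ((q+1) ^ (l + 1) + (q+1) ^ l) * ((q+1)^l * q) = (q+1) ^ (2 * N) := by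
  induction N with
  | zero => simp
  | succ N ih => rw [Finset.sum_range_succ, ← add_assoc, ih]; ring

lemma sum3 (q N K : ℕ) :
    (q+1) ^ N + ∑ l ∈ Finset.range K, ((q+1)^(N+l) * q) = (q+1) ^ (N + K) := by
  induction K with
  | zero => simp
  | succ N ih => rw [Finset.sum_range_succ, ← add_assoc, ih]; ring

lemma dim_count {p N n m s k : ℕ} (hp : p.Prime) (hN : 1 ≤ N) (hn : n = N + s) (hm : m = N + k)
    (hk : 1 ≤ k) (hks : k ≤ s) (hsm : s ≤ m) :
    ∑ x : Idx p N m s k, (p ^ (dat p N m s k x).t * p ^ (dat p N m s k x).t)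
      * Nat.totient (p ^ (dat p N m s k x).lam) = p ^ (n + m) := by
  have htot : ∀ l, Nat.totient (p ^ (l + 1)) = p ^ l * (p - 1) := fun l => by
    rw [Nat.totient_prime_pow_succ hp]
  obtain ⟨M, rfl⟩ := Nat.exists_eq_add_of_le' hN
  have hNN : p ^ (M + 1) - p ^ (M + 1 - 1) = p ^ M * (p - 1) := by
    rw [Nat.mul_sub, mul_one, Nat.add_sub_cancel, pow_succ]
  simp only [Fintype.sum_sum_type, Fintype.sum_sigma, dat, Sum.elim_inl, Sum.elim_inr,
    d2, d3, d4, d5, d6, Finset.sum_const, Finset.card_univ, Fintype.card_fin, Fintype.card_unit,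
    smul_eq_mul, pow_zero, mul_one, one_mul, Nat.totient_one]
  rw [hNN]
  rw [Fin.sum_univ_eq_sum_range (fun l => (p ^ (l + 1) + p ^ l) * (p ^ (l+1)).totient),
    Fin.sum_univ_eq_sum_range (fun l => p ^ (M + 1) * (p ^ (M + 1 + 1 + l)).totient),
    Fin.sum_univ_eq_sum_range (fun j => p ^ (M + 1) * (p ^ (j + 1) * p ^ (j+1) * (p ^ (M + 1)).totient)),
    Fin.sum_univ_eq_sum_range (fun j => p ^ (m - (k + j)) * (p ^ (k + j) * p ^ (k+j) * (p ^ (M + 1)).totient))]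
  have h5 : ∀ j : Fin (k - 1), ∑ l : Fin (m - (j.1 + 1) - (M + 1)), p ^ M * (p - 1) * (p ^ (j.1 + 1) * p ^ (j.1+1) * (p ^ (M + 1 + 1 + l.1)).totient) = (fun j => ∑ l ∈ Finset.range (k - 1 - j),
      p ^ M * (p - 1) * (p ^ (j + 1) * p ^ (j+1) * (p ^ (M + 1 + 1 + l)).totient)) j.1 := by
    intro j
    rw [Fin.sum_univ_eq_sum_range (fun l => p ^ M * (p - 1) * (p ^ (j.1 + 1) * p ^ (j.1+1) * (p ^ (M + 1 + 1 + l)).totient))]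
    simp only
    congr 2
    omega
  rw [Finset.sum_congr rfl (fun j _ => h5 j), Fin.sum_univ_eq_sum_range (fun j => ∑ l ∈ Finset.range (k - 1 - j),
      p ^ M * (p - 1) * (p ^ (j + 1) * p ^ (j+1) * (p ^ (M + 1 + 1 + l)).totient))]
  obtain ⟨q, rfl⟩ := Nat.exists_eq_add_of_le' hp.one_le
  simp only [show ∀ l, M + 1 + 1 + l = (M + 1 + l) + 1 from fun l => by ring, htot,
    Nat.add_sub_cancel]
  have e4 : ∑ j ∈ Finset.range (k - 1), (q + 1) ^ (M + 1) * ((q + 1) ^ (j + 1) * (q + 1) ^ (j + 1) * ((q + 1) ^ M * q)) +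
      ∑ j ∈ Finset.range (k - 1), ∑ l ∈ Finset.range (k - 1 - j),
        (q + 1) ^ M * q * ((q + 1) ^ (j + 1) * (q + 1) ^ (j + 1) * ((q + 1) ^ (M + 1 + l) * q)) =
      ∑ j ∈ Finset.range (k - 1), (q + 1) ^ M * q * (q + 1) ^ (m + 1 + j) := by
    rw [← Finset.sum_add_distrib]
    apply Finset.sum_congr rfl
    intro j hj
    rw [Finset.mem_range] at hj
    rw [← Finset.mul_sum, ← Finset.mul_sum]
    have := sum3 q (M + 1) (k - 1 - j)
    calc _ = (q + 1) ^ M * q * ((q + 1) ^ (j + 1) * (q + 1) ^ (j + 1) * ((q + 1) ^ (M + 1) + ∑ l ∈ Finset.range (k - 1 - j), (q + 1) ^ (M + 1 + l) * q)) := by ring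
      _ = _ := by
        rw [this, ← pow_add, ← pow_add]
        congr 2
        omega
  have e6 : ∑ j ∈ Finset.range (s - k + 1), (q + 1) ^ (m - (k + j)) * ((q + 1) ^ (k + j) * (q + 1) ^ (k + j) * ((q + 1) ^ M * q)) = ∑ j ∈ Finset.range (s - k + 1), (q + 1) ^ M * q * (q + 1) ^ (m + 1 + (k - 1 + j)) := by
    apply Finset.sum_congr rfl
    intro j hj
    rw [Finset.mem_range] at hj
    rw [show m + 1 + (k - 1 + j) = (m - (k + j)) + (k + j) + (k + j) by omega]
    ring
  have e7 : ∑ j ∈ Finset.range (k - 1), (q + 1) ^ M * q * (q + 1) ^ (m + 1 + j) + ∑ j ∈ Finset.range (s - k + 1), (q + 1) ^ M * q * (q + 1) ^ (m + 1 + (k - 1 + j)) = ∑ j ∈ Finset.range s, (q + 1) ^ M * q * (q + 1) ^ (m + 1 + j) := by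
    rw [← Finset.sum_range_add (fun j => (q + 1) ^ M * q * (q + 1) ^ (m + 1 + j)),
      show k - 1 + (s - k + 1) = s by omega]
  rw [e6, ← add_assoc, ← add_assoc, ← add_assoc, sum1, ← Finset.mul_sum,
    show m - (M + 1) = k by omega]
  have e3 := sum3 q (M + 1) k
  have e3' := sum3 q (m + 1 + M) s
  rw [add_assoc (_ + _) (Finset.sum _ _) (_ + _),
    ← add_assoc (Finset.sum _ _) (Finset.sum _ _) (Finset.sum _ _), e4, e7]
  have e8 : ∑ j ∈ Finset.range s, (q + 1) ^ M * q * (q + 1) ^ (m + 1 + j) = ∑ l ∈ Finset.range s, (q + 1) ^ (m + 1 + M + l) * q :=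
    Finset.sum_congr rfl (fun j _ => by ring)
  rw [e8, show (q + 1) ^ (2 * (M + 1)) = (q + 1) ^ (M + 1) * (q + 1) ^ (M + 1) by ring, ← mul_add, e3, ← pow_add, show M + 1 + (M + 1 + k) = m + 1 + M by omega, e3']
  congr 1
  omega

end MetaW

namespace MetaW

theorem main_equiv {G : Type} [Group G] {p N n m s k u : ℕ} (hp : p.Prime) (hodd : Odd p)
    (hN : 1 ≤ N) (hn : n = N + s) (hm : m = N + k) (hk : 1 ≤ k) (hks : k ≤ s) (hsm : s ≤ m)
    (hu : ¬ p ∣ u) {a b : G} (h : Meta (p ^ n) (p ^ m) (1 + p ^ N * u) a b) :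
    Nonempty (MonoidAlgebra ℚ G ≃ₐ[ℚ]
      ((x : Idx p N m s k) → Comp p (dat p N m s k x).t (dat p N m s k x).lam)) := by
  classical
  have hv := dat_valid hp hN hn hm hk hks hsm
  choose φ hφs hφ using fun x => comp_exists hp hodd hN hu h (dat p N m s k x) (hv x)
  have hne : ∀ t, NeZero (p ^ t) := fun t => ⟨(pow_pos hp.pos t).ne'⟩
  let Φ : MonoidAlgebra ℚ G →ₐ[ℚ]
      ((x : Idx p N m s k) → Comp p (dat p N m s k x).t (dat p N m s k x).lam) := AlgHom.pi φ
  have hsurj : Function.Surjective Φ := by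
    refine pi_surjective (fun x => (φ x).toRingHom) hφs ?_
    intro x y hxy
    exact dat_inj hp hN hk (dat_eq hp hN _ _ (hv x) (hv y) (φ x) (φ y) (hφ x) (hφ y) hxy)
  have hcard : Nat.card G = p ^ (n + m) := by rw [h.hcard, pow_add]
  have hfin : Finite G := Nat.finite_of_card_ne_zero (by rw [hcard]; exact (pow_pos hp.pos _).ne')
  have := Fintype.ofFinite G
  have hd1 : Module.finrank ℚ (MonoidAlgebra ℚ G) = p ^ (n + m) := by
    rw [← hcard, Module.finrank_eq_nat_card_basis (MonoidAlgebra.basis G ℚ)]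
  have hd2 : Module.finrank ℚ
      ((x : Idx p N m s k) → Comp p (dat p N m s k x).t (dat p N m s k x).lam) = p ^ (n + m) := by
    rw [Module.finrank_pi_fintype, ← dim_count hp hN hn hm hk hks hsm]
    apply Finset.sum_congr rfl
    intro x _
    have := hne (dat p N m s k x).lam
    have : NeZero ((p ^ (dat p N m s k x).lam : ℕ) : ℚ) :=
      ⟨by exact_mod_cast (pow_pos hp.pos _).ne'⟩
    have : IsCyclotomicExtension {p ^ (dat p N m s k x).lam} ℚ
      (CyclotomicField (p ^ (dat p N m s k x).lam) ℚ) :=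
      CyclotomicField.isCyclotomicExtension _ _
    rw [Module.finrank_matrix, Fintype.card_fin,
      IsCyclotomicExtension.finrank (n := p ^ (dat p N m s k x).lam) (CyclotomicField (p ^ (dat p N m s k x).lam) ℚ)
      (Polynomial.cyclotomic.irreducible_rat (pow_pos hp.pos _))]
  have hfd : Module.Finite ℚ (MonoidAlgebra ℚ G) := Module.Finite.of_basis (MonoidAlgebra.basis G ℚ)
  have hinj : Function.Injective Φ := by
    have := LinearMap.injective_iff_surjective_of_finrank_eq_finrank (hd1.trans hd2.symm) (f := Φ.toLinearMap)
    exact this.2 hsurj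
  exact ⟨AlgEquiv.ofBijective Φ ⟨hinj, hsurj⟩⟩

end MetaW

namespace MetaW

/-- Functions on a sum type as a product of function algebras. -/
def piSum {α β : Type} (B : α ⊕ β → Type) [∀ x, Ring (B x)] [∀ x, Algebra ℚ (B x)] :
    ((x : α ⊕ β) → B x) ≃ₐ[ℚ] ((x : α) → B (Sum.inl x)) × ((x : β) → B (Sum.inr x)) :=
  { Equiv.sumPiEquivProdPi B with
    map_mul' := fun _ _ => rfl
    map_add' := fun _ _ => rfl
    commutes' := fun _ => rfl }

/-- Currying of functions on a sigma type. -/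
def piSigma {α : Type} {β : α → Type} (B : (a : α) → β a → Type) [∀ a b, Ring (B a b)]
    [∀ a b, Algebra ℚ (B a b)] :
    ((x : Σ a, β a) → B x.1 x.2) ≃ₐ[ℚ] ((a : α) → (b : β a) → B a b) :=
  { Equiv.piCurry B with
    map_mul' := fun _ _ => rfl
    map_add' := fun _ _ => rfl
    commutes' := fun _ => rfl }

/-- Functions on the one point type. -/
def piUnit (B : Unit → Type) [∀ a, Ring (B a)] [∀ a, Algebra ℚ (B a)] :
    ((x : Unit) → B x) ≃ₐ[ℚ] B () :=
  { toFun := fun f => f ()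
    invFun := fun y _ => y
    left_inv := fun _ => rfl
    right_inv := fun _ => rfl
    map_mul' := fun _ _ => rfl
    map_add' := fun _ _ => rfl
    commutes' := fun _ => rfl }

/-- One by one matrices. -/
noncomputable def oneMat (p lam : ℕ) : Comp p 0 lam ≃ₐ[ℚ] CyclotomicField (p ^ lam) ℚ :=
  AlgEquiv.symm <| AlgEquiv.ofBijective
    (IsScalarTower.toAlgHom ℚ (CyclotomicField (p ^ lam) ℚ) (Comp p 0 lam)) (by
    have hsub : ∀ i j : Fin (p ^ 0), i = j := by
      intro i j
      have h1 := i.2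
      have h2 := j.2
      have h0 : p ^ 0 = 1 := pow_zero p
      exact Fin.ext (by omega)
    have key : ∀ (x : CyclotomicField (p ^ lam) ℚ) (i : Fin (p ^ 0)),
        (IsScalarTower.toAlgHom ℚ (CyclotomicField (p ^ lam) ℚ) (Comp p 0 lam) x) i i = x := by
      intro x i
      rw [IsScalarTower.coe_toAlgHom', Matrix.algebraMap_matrix_apply]
      rw [if_pos rfl]
      rfl
    let i0 : Fin (p ^ 0) := ⟨0, by simp⟩
    constructor
    · intro x y h
      have := congrFun (congrFun h i0) i0
      exact (key x i0).symm.trans (this.trans (key y i0))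
    · intro M
      refine ⟨M i0 i0, ?_⟩
      ext i j
      rw [hsub i i0, hsub j i0]
      exact key _ _)

/-- The trivial cyclotomic field. -/
noncomputable def trivCyc (p : ℕ) : CyclotomicField (p ^ 0) ℚ ≃ₐ[ℚ] ℚ :=
  AlgEquiv.symm <| AlgEquiv.ofBijective (Algebra.ofId ℚ (CyclotomicField (p ^ 0) ℚ)) (by
    refine ⟨(algebraMap ℚ (CyclotomicField (p ^ 0) ℚ)).injective, ?_⟩
    have h1 : NeZero ((p ^ 0 : ℕ) : ℚ) := ⟨by simp⟩
    have h2 : IsCyclotomicExtension {p ^ 0} ℚ (CyclotomicField (p ^ 0) ℚ) :=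
      CyclotomicField.isCyclotomicExtension _ _
    have h3 : IsCyclotomicExtension {1} ℚ (CyclotomicField (p ^ 0) ℚ) := by
      simpa only [pow_zero] using h2
    have h4 := IsCyclotomicExtension.singleton_one (A := ℚ) (B := CyclotomicField (p ^ 0) ℚ)
    exact Algebra.surjective_algebraMap_iff.2 h4.symm)

noncomputable def finalEquiv (p N m s k : ℕ) :
    ((x : Idx p N m s k) → Comp p (dat p N m s k x).t (dat p N m s k x).lam) ≃ₐ[ℚ]
        ℚ ×
        ((l : Fin N) → Fin (p ^ (l.1 + 1) + p ^ l.1) → CyclotomicField (p ^ (l.1 + 1)) ℚ) ×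
        ((l : Fin (m - N)) → Fin (p ^ N) → CyclotomicField (p ^ (N + 1 + l.1)) ℚ) ×
        ((j : Fin (k - 1)) → Fin (p ^ N) → Comp p (j.1 + 1) N) ×
        ((j : Fin (k - 1)) → (l : Fin (m - (j.1 + 1) - N)) →
          Fin (p ^ N - p ^ (N - 1)) → Comp p (j.1 + 1) (N + 1 + l.1)) ×
        ((j : Fin (s - k + 1)) → Fin (p ^ (m - (k + j.1))) → Comp p (k + j.1) N) :=
  (piSum _).trans <| AlgEquiv.prodCongr
    ((piUnit (fun _ => Comp p 0 0)).trans ((oneMat p 0).trans (trivCyc p))) <|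
  (piSum _).trans <| AlgEquiv.prodCongr
    ((piSigma (β := fun l : Fin N => Fin (p ^ (l.1 + 1) + p ^ l.1))
      (fun l _ => Comp p 0 (l.1 + 1))).trans
      (AlgEquiv.piCongrRight fun l => AlgEquiv.piCongrRight fun _ => oneMat p (l.1 + 1))) <|
  (piSum _).trans <| AlgEquiv.prodCongr
    ((piSigma (β := fun _ : Fin (m - N) => Fin (p ^ N))
      (fun l _ => Comp p 0 (N + 1 + l.1))).trans
      (AlgEquiv.piCongrRight fun l => AlgEquiv.piCongrRight fun _ => oneMat p (N + 1 + l.1))) <|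
  (piSum _).trans <| AlgEquiv.prodCongr
    (piSigma (β := fun _ : Fin (k - 1) => Fin (p ^ N)) (fun j _ => Comp p (j.1 + 1) N)) <|
  (piSum _).trans <| AlgEquiv.prodCongr
    ((piSigma (β := fun j : Fin (k - 1) =>
        Σ _ : Fin (m - (j.1 + 1) - N), Fin (p ^ N - p ^ (N - 1)))
      (fun j x => Comp p (j.1 + 1) (N + 1 + x.1.1))).trans
      (AlgEquiv.piCongrRight fun j => piSigma
        (β := fun _ : Fin (m - (j.1 + 1) - N) => Fin (p ^ N - p ^ (N - 1)))
        (fun l _ => Comp p (j.1 + 1) (N + 1 + l.1)))) <|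
  (piSigma (β := fun j : Fin (s - k + 1) => Fin (p ^ (m - (k + j.1))))
    (fun j _ => Comp p (k + j.1) N))

end MetaW

/-- **Theorem (Wedderburn decomposition, case `n - s < m`, `k ≤ s`).**
Let `p` be an odd prime and let
`G = ⟨a, b | a^(p^n) = b^(p^m) = 1, b a b⁻¹ = a^r⟩` be the split metacyclic
`p`-group, with `n ≥ 2`, `m ≥ 1`, `gcd(r, p^n) = 1`, `r` of multiplicative
order `p^s` modulo `p^n` and `1 ≤ s ≤ min {n-1, m}`.  (Such a group is
characterized up to isomorphism by: `|G| = p^(n+m)`, generators `a, b` of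
orders `p^n`, `p^m` with `b a b⁻¹ = a^r`.)  Suppose `n - s < m`,
`m = (n-s) + k` and `k ≤ s`.  Then
`ℚG ≅ ℚ ⊕ ⨁_{λ=1}^{n-s} (p^λ + p^(λ-1)) ℚ(ζ_{p^λ})
     ⊕ ⨁_{λ=n-s+1}^{m} p^(n-s) ℚ(ζ_{p^λ})
     ⊕ ⨁_{t=1}^{k-1} p^(n-s) M_{p^t}(ℚ(ζ_{p^(n-s)}))
     ⊕ ⨁_{t=1}^{k-1} ⨁_{λ=n-s+1}^{m-t} (p^(n-s) − p^(n-s-1)) M_{p^t}(ℚ(ζ_{p^λ}))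
     ⊕ ⨁_{t=k}^{s} p^(m-t) M_{p^t}(ℚ(ζ_{p^(n-s)}))`
as `ℚ`-algebras.  (Sums over `λ = 1..n-s`, `λ = n-s+1..m`, `t = 1..k-1`, and
`t = k..s` are reindexed by `l : Fin (n-s)` with `λ = l+1`,
`l : Fin (m-(n-s))` with `λ = n-s+1+l`, `j : Fin (k-1)` with `t = j+1`, and
`j : Fin (s-k+1)` with `t = k+j`, respectively.) -/
theorem stmt_1 (p n m s k : ℕ) (r : ℤ) (hp : p.Prime) (hodd : Odd p)
    (hn : 2 ≤ n) (hm : 1 ≤ m) (hs1 : 1 ≤ s) (hsn : s ≤ n - 1) (hsm : s ≤ m)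
    (hr : Int.gcd r (p ^ n) = 1) (hord : orderOf ((r : ZMod (p ^ n))) = p ^ s)
    (G : Type) [Group G] (a b : G)
    (hcard : Nat.card G = p ^ (n + m))
    (ha : orderOf a = p ^ n) (hb : orderOf b = p ^ m)
    (hrel : b * a * b⁻¹ = a ^ r)
    (hgen : Subgroup.closure {a, b} = ⊤)
    (hcase : n - s < m) (hk : m = (n - s) + k) (hks : k ≤ s) :
    Nonempty
      (MonoidAlgebra ℚ G ≃ₐ[ℚ]
        ℚ ×
        ((l : Fin (n - s)) → Fin (p ^ (l.1 + 1) + p ^ l.1) →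
          CyclotomicField (p ^ (l.1 + 1)) ℚ) ×
        ((l : Fin (m - (n - s))) → Fin (p ^ (n - s)) →
          CyclotomicField (p ^ (n - s + 1 + l.1)) ℚ) ×
        ((j : Fin (k - 1)) → Fin (p ^ (n - s)) →
          Matrix (Fin (p ^ (j.1 + 1))) (Fin (p ^ (j.1 + 1)))
            (CyclotomicField (p ^ (n - s)) ℚ)) ×
        ((j : Fin (k - 1)) → (l : Fin (m - (j.1 + 1) - (n - s))) →
          Fin (p ^ (n - s) - p ^ (n - s - 1)) →
          Matrix (Fin (p ^ (j.1 + 1))) (Fin (p ^ (j.1 + 1)))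
            (CyclotomicField (p ^ (n - s + 1 + l.1)) ℚ)) ×
        ((j : Fin (s - k + 1)) → Fin (p ^ (m - (k + j.1))) →
          Matrix (Fin (p ^ (k + j.1))) (Fin (p ^ (k + j.1)))
            (CyclotomicField (p ^ (n - s)) ℚ))) := by
  obtain ⟨u, hu, hR⟩ := MetaW.exists_R hp hodd hs1 hsn hord
  have hmeta : MetaW.Meta (p ^ n) (p ^ m) (1 + p ^ (n - s) * u) a b := by
    refine ⟨pow_pos hp.pos _, pow_pos hp.pos _, ?_, ?_, ?_, ?_, hgen⟩
    · rw [← ha, pow_orderOf_eq_one]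
    · rw [← hb, pow_orderOf_eq_one]
    · have h1 : a ^ r = a ^ (1 + p ^ (n - s) * u) := by
        rw [← zpow_natCast, zpow_eq_zpow_iff_modEq, ha]
        rw [← ZMod.intCast_eq_intCast_iff, ← hR]
        simp
      rw [← h1, ← hrel]
      group
    · rw [hcard, pow_add]
  obtain ⟨e⟩ := MetaW.main_equiv (N := n - s) (k := k) hp hodd (by omega) (by omega) hk
    (by omega) hks hsm hu hmeta
  exact ⟨e.trans (MetaW.finalEquiv p (n - s) m s k)⟩
end
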